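/- arXiv:2311.10896 — 2 statements merged into one kernel-verified Lean document; each statement's English description precedes it below -/
import Mathlib

section
/- For ν ∈ ℝ and ℓ, m ∈ ℕ₀ with ν+ℓ+m > -1, the first-kind Bessel functions satisfy the orthogonality relation ∫_0^∞ t^{-1} J_{ν+2ℓ+1}(t) J_{ν+2m+1}(t) dt = δ_{ℓ,m} / (2(2ℓ+ν+1)). -/
open scoped BigOperators
open MeasureTheory

/-- The Bessel function of the first kind
`J_μ(t) = (t/2)^μ Σ_{k≥0} (-1)^k (t²/4)^k / (k! Γ(μ+k+1))`. -/
noncomputable def besselJ (μ t : ℝ) : ℝ :=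
  (t / 2) ^ μ * ∑' k : ℕ, (-1) ^ k * (t ^ 2 / 4) ^ k /
    ((k.factorial : ℝ) * Real.Gamma (μ + k + 1))

open Filter Topology Set

/-- The `k`-th coefficient of the entire function `t ↦ (t / 2) ^ (-μ) * besselJ μ t`, expanded in
powers of `t ^ 2 / 4`. -/
noncomputable def besselCoeff (μ : ℝ) (k : ℕ) : ℝ :=
  (-1) ^ k / ((k.factorial : ℝ) * Real.Gamma (μ + k + 1))

/-- The entire function with `besselJ μ t = (t / 2) ^ μ * besselEntire μ (t ^ 2 / 4)`. -/
noncomputable def besselEntire (μ x : ℝ) : ℝ := ∑' k : ℕ, besselCoeff μ k * x ^ k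

theorem besselJ_eq (μ t : ℝ) : besselJ μ t = (t / 2) ^ μ * besselEntire μ (t ^ 2 / 4) := by
  simp only [besselJ, besselEntire, besselCoeff, mul_div_right_comm]

theorem inv_Gamma_eq (x : ℝ) : (Real.Gamma x)⁻¹ = x * (Real.Gamma (x + 1))⁻¹ := by
  rcases eq_or_ne x 0 with rfl | hx
  · simp [Real.Gamma_zero]
  · rw [Real.Gamma_add_one hx, mul_inv, mul_inv_cancel_left₀ hx]

theorem besselCoeff_eq_mul (μ : ℝ) (k : ℕ) :
    besselCoeff μ k = (μ + k + 1) * besselCoeff (μ + 1) k := by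
  simp only [besselCoeff, div_eq_mul_inv, mul_inv]
  rw [inv_Gamma_eq (μ + k + 1), show μ + 1 + k + 1 = μ + k + 1 + 1 by ring]
  ring

theorem besselCoeff_succ (μ : ℝ) (k : ℕ) :
    (k + 1) * besselCoeff μ (k + 1) = -besselCoeff (μ + 1) k := by
  have hk : (k + 1 : ℝ) ≠ 0 := by positivity
  simp only [besselCoeff, div_eq_mul_inv, mul_inv, Nat.factorial_succ, Nat.cast_mul, Nat.cast_succ]
  rw [show μ + (k + 1 : ℝ) + 1 = μ + 1 + k + 1 by ring, pow_succ]
  field_simp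

theorem exists_abs_besselCoeff_le (μ : ℝ) :
    ∃ C, 0 ≤ C ∧ ∀ k, |besselCoeff μ k| ≤ C / (k.factorial : ℝ) := by
  obtain ⟨K, hK⟩ := exists_nat_ge (1 - μ)
  refine ⟨1 + ∑ i ∈ Finset.range K, |(Real.Gamma (μ + i + 1))⁻¹|, by positivity, fun k => ?_⟩
  have h1 : |besselCoeff μ k| = |(Real.Gamma (μ + k + 1))⁻¹| / (k.factorial : ℝ) := by
    simp [besselCoeff, abs_div, abs_mul, abs_inv]
    field_simp
  rw [h1]
  gcongr
  rcases lt_or_ge k K with h | h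
  · have := Finset.single_le_sum (f := fun i : ℕ => |(Real.Gamma (μ + i + 1))⁻¹|)
      (fun i _ => abs_nonneg _) (Finset.mem_range.2 h)
    linarith
  · have h2 : (2 : ℝ) ≤ μ + k + 1 := by
      have : (K : ℝ) ≤ k := by exact_mod_cast h
      linarith
    have h3 : 1 ≤ Real.Gamma (μ + k + 1) := by
      have := Real.Gamma_strictMonoOn_Ici.monotoneOn (mem_Ici.2 le_rfl) h2 h2
      rwa [Real.Gamma_two] at this
    have h4 : 0 ≤ ∑ i ∈ Finset.range K, |(Real.Gamma (μ + i + 1))⁻¹| := by positivity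
    rw [abs_inv, abs_of_pos (by linarith)]
    have := inv_le_one_of_one_le₀ h3
    linarith

theorem summable_abs_besselCoeff_mul_pow (μ x : ℝ) :
    Summable fun k => |besselCoeff μ k * x ^ k| := by
  obtain ⟨C, hC, h⟩ := exists_abs_besselCoeff_le μ
  refine Summable.of_nonneg_of_le (fun _ => abs_nonneg _) (fun k => ?_)
    ((Real.summable_pow_div_factorial |x|).mul_left C)
  rw [abs_mul, abs_pow]
  calc _ ≤ C / (k.factorial : ℝ) * |x| ^ k := by gcongr; exact h k
    _ = _ := by ring

theorem summable_besselCoeff_mul_pow (μ x : ℝ) : Summable fun k => besselCoeff μ k * x ^ k :=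
  (summable_abs_besselCoeff_mul_pow μ x).of_abs

theorem hasSum_besselEntire (μ x : ℝ) :
    HasSum (fun k => besselCoeff μ k * x ^ k) (besselEntire μ x) :=
  (summable_besselCoeff_mul_pow μ x).hasSum

theorem besselEntire_zero (μ : ℝ) : besselEntire μ 0 = (Real.Gamma (μ + 1))⁻¹ := by
  rw [besselEntire, tsum_eq_single 0 (by intro k hk; simp [hk])]
  simp [besselCoeff]

theorem hasDerivAt_besselEntire (μ x : ℝ) :
    HasDerivAt (besselEntire μ) (-besselEntire (μ + 1) x) x := by
  have hsum : ∑' k : ℕ, besselCoeff μ k * (k * x ^ (k - 1)) = -besselEntire (μ + 1) x := by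
    have h : HasSum (fun k : ℕ => besselCoeff μ k * (k * x ^ (k - 1)))
        (-besselEntire (μ + 1) x) := by
      rw [← hasSum_nat_add_iff' 1]
      simp only [Finset.range_one, Finset.sum_singleton, Nat.cast_zero, zero_mul, mul_zero,
        sub_zero]
      convert (hasSum_besselEntire (μ + 1) x).neg using 1
      funext k
      rw [← neg_mul, ← besselCoeff_succ, Nat.add_sub_cancel]
      push_cast
      ring
    exact h.tsum_eq
  rw [← hsum]
  have hu : Summable fun k : ℕ => |besselCoeff μ k| * (k * (|x| + 1) ^ (k - 1)) := by
    rw [← summable_nat_add_iff 1]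
    refine (summable_abs_besselCoeff_mul_pow (μ + 1) (|x| + 1)).congr fun k => ?_
    have := congrArg abs (besselCoeff_succ μ k)
    rw [abs_neg, abs_mul, abs_of_nonneg (by positivity)] at this
    rw [abs_mul, ← this, abs_of_nonneg (by positivity : 0 ≤ (|x| + 1) ^ k)]
    rw [Nat.add_sub_cancel]
    push_cast
    ring
  refine hasDerivAt_tsum_of_isPreconnected (t := Metric.ball 0 (|x| + 1)) (y₀ := 0) hu
    Metric.isOpen_ball (convex_ball _ _).isPreconnected
    (g := fun k y => besselCoeff μ k * y ^ k)
    (g' := fun k y => besselCoeff μ k * (k * y ^ (k - 1))) ?_ ?_ ?_ ?_ ?_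
  · intro k y _
    exact (hasDerivAt_pow k y).const_mul _
  · intro k y hy
    rw [mem_ball_zero_iff, Real.norm_eq_abs] at hy
    rw [Real.norm_eq_abs, abs_mul, abs_mul, Nat.abs_cast, abs_pow]
    gcongr
  · exact Metric.mem_ball_self (by positivity)
  · exact summable_besselCoeff_mul_pow μ 0
  · simp

theorem continuous_besselEntire (μ : ℝ) : Continuous (besselEntire μ) :=
  continuous_iff_continuousAt.2 fun x => (hasDerivAt_besselEntire μ x).continuousAt

theorem besselEntire_recurrence (μ x : ℝ) :
    besselEntire μ x = (μ + 1) * besselEntire (μ + 1) x - x * besselEntire (μ + 2) x := by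
  have key : ∀ k : ℕ, besselCoeff μ k * x ^ k =
      (μ + 1) * (besselCoeff (μ + 1) k * x ^ k) + k * besselCoeff (μ + 1) k * x ^ k := fun k => by
    rw [besselCoeff_eq_mul]; ring
  have h1 : HasSum (fun k : ℕ => (k : ℝ) * besselCoeff (μ + 1) k * x ^ k)
      (-(x * besselEntire (μ + 2) x)) := by
    rw [← hasSum_nat_add_iff' 1]
    have := ((hasSum_besselEntire (μ + 2) x).mul_left x).neg
    simp only [Finset.range_one, Finset.sum_singleton, Nat.cast_zero, zero_mul, sub_zero]
    convert this using 1
    funext k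
    push_cast
    rw [besselCoeff_succ, show μ + 1 + 1 = μ + 2 by ring]
    ring
  have h2 := ((hasSum_besselEntire (μ + 1) x).mul_left (μ + 1)).add h1
  rw [besselEntire, tsum_congr key, h2.tsum_eq, sub_eq_add_neg]

theorem hasDerivAt_besselJ (μ : ℝ) {t : ℝ} (ht : 0 < t) :
    HasDerivAt (besselJ μ) (μ / t * besselJ μ t - besselJ (μ + 1) t) t := by
  have h1 : HasDerivAt (fun t : ℝ => (t / 2) ^ μ) (1 / 2 * μ * (t / 2) ^ (μ - 1)) t :=
    ((hasDerivAt_id t).div_const 2).rpow_const (Or.inl (by simp; positivity))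
  have h2 : HasDerivAt (fun t : ℝ => t ^ 2 / 4) (t / 2) t := by
    refine ((hasDerivAt_pow 2 t).div_const 4).congr_deriv ?_
    push_cast
    ring
  have h3 := h1.mul ((hasDerivAt_besselEntire μ (t ^ 2 / 4)).comp t h2)
  have h4 : besselJ μ = fun t => (t / 2) ^ μ * besselEntire μ (t ^ 2 / 4) :=
    funext fun t => besselJ_eq μ t
  rw [h4, besselJ_eq]
  refine h3.congr_deriv ?_
  have ht2 : 0 < t / 2 := by positivity
  rw [Real.rpow_sub_one ht2.ne', Real.rpow_add_one ht2.ne']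
  simp only [Function.comp]
  field_simp
  ring

theorem besselJ_add_two (μ : ℝ) {t : ℝ} (ht : 0 < t) :
    besselJ (μ + 2) t = 2 * (μ + 1) / t * besselJ (μ + 1) t - besselJ μ t := by
  have ht2 : 0 < t / 2 := by positivity
  rw [besselJ_eq, besselJ_eq, besselJ_eq, besselEntire_recurrence μ,
    show μ + 2 = μ + 1 + 1 by ring, Real.rpow_add_one ht2.ne', Real.rpow_add_one ht2.ne']
  field_simp
  ring

theorem hasDerivAt_besselJ_add_one (μ : ℝ) {t : ℝ} (ht : 0 < t) :
    HasDerivAt (besselJ (μ + 1)) (besselJ μ t - (μ + 1) / t * besselJ (μ + 1) t) t := by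
  refine (hasDerivAt_besselJ (μ + 1) ht).congr_deriv ?_
  rw [show μ + 1 + 1 = μ + 2 by ring, besselJ_add_two μ ht]
  ring

theorem continuousOn_besselJ (μ : ℝ) : ContinuousOn (besselJ μ) (Ioi 0) := fun _ ht =>
  (hasDerivAt_besselJ μ ht).continuousAt.continuousWithinAt

theorem measurable_besselJ (μ : ℝ) : Measurable (besselJ μ) := by
  have h4 : besselJ μ = fun t => (t / 2) ^ μ * besselEntire μ (t ^ 2 / 4) :=
    funext fun t => besselJ_eq μ t
  have := (continuous_besselEntire μ).measurable
  rw [h4]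
  fun_prop

theorem exists_abs_besselJ_le_of_le (μ T : ℝ) :
    ∃ C, 0 ≤ C ∧ ∀ t, 0 < t → t ≤ T → |besselJ μ t| ≤ C * t ^ μ := by
  obtain ⟨C, hC⟩ := (isCompact_Icc (a := (0 : ℝ)) (b := T)).exists_bound_of_continuousOn
    (f := fun t => besselEntire μ (t ^ 2 / 4))
    ((continuous_besselEntire μ).comp (by fun_prop)).continuousOn
  refine ⟨(1 / 2) ^ μ * |C|, by positivity, fun t ht hT => ?_⟩
  rw [besselJ_eq, abs_mul, abs_of_nonneg (by positivity), div_eq_inv_mul,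
    Real.mul_rpow (by norm_num) ht.le]
  have := (hC t ⟨ht.le, hT⟩).trans (le_abs_self C)
  rw [Real.norm_eq_abs] at this
  calc _ ≤ (2⁻¹ : ℝ) ^ μ * t ^ μ * |C| := by gcongr
    _ = _ := by rw [one_div]; ring

/-- A modified energy of the Bessel equation. -/
noncomputable def besselEnergy (μ t : ℝ) : ℝ :=
  t * (besselJ μ t ^ 2 + besselJ (μ + 1) t ^ 2) - (2 * μ + 1) * (besselJ μ t * besselJ (μ + 1) t)

theorem hasDerivAt_besselEnergy (μ : ℝ) {t : ℝ} (ht : 0 < t) :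
    HasDerivAt (besselEnergy μ) ((2 * μ + 1) / t * (besselJ μ t * besselJ (μ + 1) t)) t := by
  have h1 := hasDerivAt_besselJ μ ht
  have h2 := hasDerivAt_besselJ_add_one μ ht
  refine (((hasDerivAt_id t).mul ((h1.pow 2).add (h2.pow 2))).sub
    ((h1.mul h2).const_mul (2 * μ + 1))).congr_deriv ?_
  simp
  field_simp
  ring

theorem le_besselEnergy (μ : ℝ) {t : ℝ} (ht : |2 * μ + 1| + 1 ≤ t) :
    t / 2 * (besselJ μ t ^ 2 + besselJ (μ + 1) t ^ 2) ≤ besselEnergy μ t := by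
  have h1 : (2 * μ + 1) * (besselJ μ t * besselJ (μ + 1) t) ≤
      t * ((besselJ μ t ^ 2 + besselJ (μ + 1) t ^ 2) / 2) := by
    refine (le_abs_self _).trans ?_
    rw [abs_mul]
    have : |besselJ μ t * besselJ (μ + 1) t| ≤ (besselJ μ t ^ 2 + besselJ (μ + 1) t ^ 2) / 2 := by
      rw [abs_le]
      constructor <;> nlinarith [sq_nonneg (besselJ μ t + besselJ (μ + 1) t),
        sq_nonneg (besselJ μ t - besselJ (μ + 1) t)]
    exact mul_le_mul (by linarith) this (abs_nonneg _) (by linarith [abs_nonneg (2 * μ + 1)])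
  rw [besselEnergy]
  linarith

theorem antitoneOn_besselEnergy_mul_exp (μ : ℝ) :
    AntitoneOn (fun t => besselEnergy μ t * Real.exp (|2 * μ + 1| / t))
      (Ici (|2 * μ + 1| + 1)) := by
  have hd : ∀ t ∈ Ici (|2 * μ + 1| + 1),
      HasDerivAt (fun t => besselEnergy μ t * Real.exp (|2 * μ + 1| / t))
        (((2 * μ + 1) / t * (besselJ μ t * besselJ (μ + 1) t) -
          |2 * μ + 1| / t ^ 2 * besselEnergy μ t) * Real.exp (|2 * μ + 1| / t)) t := fun t ht => by
    have ht0 : 0 < t := lt_of_lt_of_le (by positivity) (mem_Ici.1 ht)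
    have h2 : HasDerivAt (fun t : ℝ => |2 * μ + 1| / t) (-(|2 * μ + 1| / t ^ 2)) t := by
      refine ((hasDerivAt_inv ht0.ne').const_mul |2 * μ + 1|).congr_deriv ?_
      ring
    refine ((hasDerivAt_besselEnergy μ ht0).mul h2.exp).congr_deriv ?_
    ring
  refine antitoneOn_of_deriv_nonpos (convex_Ici _)
    (fun t ht => (hd t ht).continuousAt.continuousWithinAt)
    (fun t ht => (hd t (interior_subset ht)).differentiableAt.differentiableWithinAt)
    fun t ht => ?_
  have ht' := interior_subset ht
  have ht0 : 0 < t := lt_of_lt_of_le (by positivity) (mem_Ici.1 ht')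
  rw [(hd t ht').deriv]
  refine mul_nonpos_of_nonpos_of_nonneg ?_ (Real.exp_pos _).le
  rw [sub_nonpos]
  calc (2 * μ + 1) / t * (besselJ μ t * besselJ (μ + 1) t)
      ≤ |2 * μ + 1| / t * ((besselJ μ t ^ 2 + besselJ (μ + 1) t ^ 2) / 2) := by
        refine (le_abs_self _).trans ?_
        rw [abs_mul, abs_div, abs_of_pos ht0]
        gcongr
        rw [abs_le]
        constructor <;> nlinarith [sq_nonneg (besselJ μ t + besselJ (μ + 1) t),
          sq_nonneg (besselJ μ t - besselJ (μ + 1) t)]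
    _ = |2 * μ + 1| / t ^ 2 * (t / 2 * (besselJ μ t ^ 2 + besselJ (μ + 1) t ^ 2)) := by
        field_simp
    _ ≤ _ := by
        gcongr
        exact le_besselEnergy μ ht'

theorem exists_abs_besselJ_le_of_ge (μ : ℝ) :
    ∃ C, 0 ≤ C ∧ ∀ t, 1 ≤ t → |besselJ μ t| ≤ C * t ^ (-(1 / 2) : ℝ) := by
  set t₀ := |2 * μ + 1| + 1 with ht₀
  have h1 : 1 ≤ t₀ := by simp [ht₀]
  obtain ⟨B, hB⟩ := (isCompact_Icc (a := (1 : ℝ)) (b := t₀)).exists_bound_of_continuousOn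
    (f := fun t => t * besselJ μ t ^ 2)
    (continuousOn_id.mul (((continuousOn_besselJ μ).mono fun t ht =>
      lt_of_lt_of_le one_pos ht.1).pow 2))
  set D := max B (2 * (besselEnergy μ t₀ * Real.exp (|2 * μ + 1| / t₀)))
  have key : ∀ t, 1 ≤ t → t * besselJ μ t ^ 2 ≤ D := fun t ht => by
    have ht0 : 0 < t := by linarith
    rcases le_total t t₀ with h | h
    · exact ((le_abs_self _).trans (hB t ⟨ht, h⟩)).trans (le_max_left _ _)
    · refine le_trans ?_ (le_max_right _ _)
      have h2 := antitoneOn_besselEnergy_mul_exp μ (mem_Ici.2 le_rfl) h h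
      have h3 := le_besselEnergy μ h
      have h4 : 0 ≤ t / 2 * (besselJ μ t ^ 2 + besselJ (μ + 1) t ^ 2) := by positivity
      have h5 : 1 ≤ Real.exp (|2 * μ + 1| / t) := Real.one_le_exp (by positivity)
      have h6 := le_mul_of_one_le_right (h4.trans h3) h5
      have h7 : 0 ≤ t * besselJ (μ + 1) t ^ 2 := by positivity
      simp only [← ht₀] at h2
      linarith
  refine ⟨√D, by positivity, fun t ht => ?_⟩
  have ht0 : 0 < t := by linarith
  rw [Real.rpow_neg ht0.le, ← Real.sqrt_eq_rpow, ← div_eq_mul_inv, ← Real.sqrt_div' _ ht0.le]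
  refine Real.abs_le_sqrt ?_
  rw [le_div_iff₀ ht0]
  linarith [key t ht]

theorem exists_abs_besselJ_le {μ : ℝ} (hμ : 0 ≤ μ) :
    ∃ C, 0 ≤ C ∧ ∀ t, 0 < t → |besselJ μ t| ≤ C := by
  obtain ⟨A, hA, h1⟩ := exists_abs_besselJ_le_of_le μ 1
  obtain ⟨B, hB, h2⟩ := exists_abs_besselJ_le_of_ge μ
  refine ⟨max A B, by positivity, fun t ht => ?_⟩
  rcases le_total t 1 with h | h
  · refine (h1 t ht h).trans ((mul_le_of_le_one_right hA ?_).trans (le_max_left _ _))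
    exact Real.rpow_le_one ht.le h hμ
  · refine (h2 t h).trans ((mul_le_of_le_one_right hB ?_).trans (le_max_right _ _))
    exact Real.rpow_le_one_of_one_le_of_nonpos h (by norm_num)

theorem exists_abs_besselJ_le_rpow {μ : ℝ} (hμ : 0 ≤ μ) :
    ∃ C, 0 ≤ C ∧ ∀ t, 0 < t → |besselJ μ t| ≤ C * t ^ μ := by
  obtain ⟨A, hA, h1⟩ := exists_abs_besselJ_le_of_le μ 1
  obtain ⟨B, hB, h2⟩ := exists_abs_besselJ_le hμ
  refine ⟨max A B, by positivity, fun t ht => ?_⟩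
  rcases le_total t 1 with h | h
  · exact (h1 t ht h).trans (by gcongr; exact le_max_left _ _)
  · refine (h2 t ht).trans ((le_mul_of_one_le_right hB ?_).trans
      (mul_le_mul_of_nonneg_right (le_max_right A B) (by positivity)))
    exact Real.one_le_rpow h hμ

/-- A function on `(0, ∞)` that is `O(t ^ (p - 1))` at zero with `0 < p` and `O(t ^ (-q - 1))` at
infinity with `0 < q` is integrable. -/
theorem integrableOn_Ioi_zero_of_abs_le {f : ℝ → ℝ} (hf : Measurable f) {p q A B : ℝ}
    (hp : 0 < p) (hq : 0 < q) (h0 : ∀ t, 0 < t → t ≤ 1 → |f t| ≤ A * t ^ (p - 1))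
    (h1 : ∀ t, 1 ≤ t → |f t| ≤ B * t ^ (-q - 1)) : IntegrableOn f (Ioi 0) := by
  rw [← Ioc_union_Ioi_eq_Ioi zero_le_one]
  refine IntegrableOn.union ?_ ?_
  · have : IntegrableOn (fun t : ℝ => A * t ^ (p - 1)) (Ioc 0 1) := by
      rw [← intervalIntegrable_iff_integrableOn_Ioc_of_le zero_le_one]
      exact (intervalIntegral.intervalIntegrable_rpow' (by linarith)).const_mul A
    refine Integrable.mono' this hf.aestronglyMeasurable ?_
    exact (ae_restrict_mem measurableSet_Ioc).mono fun t ht => h0 t ht.1 ht.2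
  · have : IntegrableOn (fun t : ℝ => B * t ^ (-q - 1)) (Ioi 1) :=
      (integrableOn_Ioi_rpow_of_lt (by linarith) one_pos).const_mul B
    refine Integrable.mono' this hf.aestronglyMeasurable ?_
    exact (ae_restrict_mem measurableSet_Ioi).mono fun t ht => h1 t (le_of_lt ht)

theorem integrableOn_besselJ_mul_besselJ {a b : ℝ} (hab : 0 < a + b) :
    IntegrableOn (fun t => t⁻¹ * besselJ a t * besselJ b t) (Ioi 0) := by
  obtain ⟨A, hA, ha⟩ := exists_abs_besselJ_le_of_le a 1
  obtain ⟨B, hB, hb⟩ := exists_abs_besselJ_le_of_le b 1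
  obtain ⟨A', hA', ha'⟩ := exists_abs_besselJ_le_of_ge a
  obtain ⟨B', hB', hb'⟩ := exists_abs_besselJ_le_of_ge b
  have := measurable_besselJ a
  have := measurable_besselJ b
  refine integrableOn_Ioi_zero_of_abs_le (by fun_prop) hab one_pos (A := A * B) (B := A' * B')
    (fun t ht h => ?_) fun t h => ?_
  · rw [abs_mul, abs_mul, abs_inv, abs_of_pos ht]
    calc t⁻¹ * |besselJ a t| * |besselJ b t| ≤ t⁻¹ * (A * t ^ a) * (B * t ^ b) := by
          gcongr
          exacts [ha t ht h, hb t ht h]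
      _ = _ := by rw [Real.rpow_sub_one ht.ne', Real.rpow_add ht]; ring
  · have ht : 0 < t := by linarith
    rw [abs_mul, abs_mul, abs_inv, abs_of_pos ht]
    calc t⁻¹ * |besselJ a t| * |besselJ b t|
          ≤ t⁻¹ * (A' * t ^ (-(1 / 2) : ℝ)) * (B' * t ^ (-(1 / 2) : ℝ)) := by
          gcongr
          exacts [ha' t h, hb' t h]
      _ = A' * B' * (t ^ (-(1 / 2) : ℝ) * t ^ (-(1 / 2) : ℝ)) * t⁻¹ := by ring
      _ = _ := by
          rw [← Real.rpow_add ht, Real.rpow_sub_one ht.ne']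
          norm_num
          ring

theorem integrableOn_inv_mul_besselJ {μ : ℝ} (hμ : 0 < μ) :
    IntegrableOn (fun t => t⁻¹ * besselJ μ t) (Ioi 0) := by
  obtain ⟨A, hA, ha⟩ := exists_abs_besselJ_le_of_le μ 1
  obtain ⟨A', hA', ha'⟩ := exists_abs_besselJ_le_of_ge μ
  have := measurable_besselJ μ
  refine integrableOn_Ioi_zero_of_abs_le (by fun_prop) hμ one_half_pos (A := A) (B := A')
    (fun t ht h => ?_) fun t h => ?_
  · rw [abs_mul, abs_inv, abs_of_pos ht, Real.rpow_sub_one ht.ne', mul_div_assoc', div_eq_inv_mul]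
    gcongr
    exact ha t ht h
  · have ht : 0 < t := by linarith
    rw [abs_mul, abs_inv, abs_of_pos ht, Real.rpow_sub_one ht.ne', mul_div_assoc', div_eq_inv_mul]
    gcongr
    exact ha' t h

theorem integral_Ioi_eq_zero_of_hasDerivAt {f f' : ℝ → ℝ}
    (hd : ∀ t ∈ Ioi (0 : ℝ), HasDerivAt f (f' t) t) (hf' : IntegrableOn f' (Ioi 0))
    (h0 : Tendsto f (𝓝[>] 0) (𝓝 0)) (h1 : Tendsto f atTop (𝓝 0)) : ∫ t in Ioi 0, f' t = 0 := by
  have := integral_Ioi_deriv_mul_eq_sub (u := f) (u' := f') (v := fun _ => (1 : ℝ))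
    (v' := fun _ => 0) (a := 0) (a' := 0) (b' := 0) hd (fun x _ => hasDerivAt_const x 1)
    (by simpa [Pi.mul_def, Pi.add_def] using hf') (by simpa [Pi.mul_def] using h0)
    (by simpa [Pi.mul_def] using h1)
  simpa using this

theorem tendsto_besselJ_mul_besselJ_zero {a b : ℝ} (hab : 0 < a + b) :
    Tendsto (fun t => besselJ a t * besselJ b t) (𝓝[>] 0) (𝓝 0) := by
  obtain ⟨A, hA, ha⟩ := exists_abs_besselJ_le_of_le a 1
  obtain ⟨B, hB, hb⟩ := exists_abs_besselJ_le_of_le b 1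
  have h : Tendsto (fun t : ℝ => A * B * t ^ (a + b)) (𝓝[>] 0) (𝓝 0) := by
    have := ((Real.continuousAt_rpow_const 0 (a + b) (Or.inr hab.le)).tendsto.const_mul
      (A * B)).mono_left (nhdsWithin_le_nhds (s := Ioi 0))
    simpa [Real.zero_rpow hab.ne'] using this
  refine squeeze_zero_norm' ?_ h
  filter_upwards [Ioo_mem_nhdsGT one_pos] with t ht
  rw [Real.norm_eq_abs, abs_mul]
  calc |besselJ a t| * |besselJ b t| ≤ (A * t ^ a) * (B * t ^ b) := by
        gcongr
        exacts [mul_nonneg hA (Real.rpow_nonneg ht.1.le _), ha t ht.1 ht.2.le, hb t ht.1 ht.2.le]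
    _ = _ := by rw [Real.rpow_add ht.1]; ring

theorem besselJ_isBigO (μ : ℝ) : besselJ μ =O[atTop] fun t : ℝ => t ^ (-(1 / 2) : ℝ) := by
  obtain ⟨C, hC, h⟩ := exists_abs_besselJ_le_of_ge μ
  refine Asymptotics.IsBigO.of_bound C ?_
  filter_upwards [eventually_ge_atTop 1] with t ht
  rw [Real.norm_eq_abs, Real.norm_eq_abs, abs_of_nonneg (Real.rpow_nonneg (by linarith) _)]
  exact h t ht

theorem besselJ_add_even_isBigO (μ : ℝ) (k : ℕ) :
    (fun t => besselJ (μ + 2 * k) t - (-1) ^ k * besselJ μ t) =O[atTop]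
      fun t : ℝ => t ^ (-(3 / 2) : ℝ) := by
  induction k with
  | zero => simpa using Asymptotics.isBigO_zero _ _
  | succ k ih =>
    have h1 : (fun t : ℝ => 2 * (μ + 2 * k + 1) * (t⁻¹ * besselJ (μ + 2 * k + 1) t)) =O[atTop]
        fun t : ℝ => t ^ (-(3 / 2) : ℝ) := by
      refine Asymptotics.IsBigO.const_mul_left ?_ _
      refine ((Asymptotics.isBigO_refl (fun t : ℝ => t⁻¹) atTop).mul
        (besselJ_isBigO (μ + 2 * k + 1))).congr' EventuallyEq.rfl ?_
      filter_upwards [eventually_gt_atTop 0] with t ht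
      rw [← Real.rpow_neg_one, ← Real.rpow_add ht]
      norm_num
    refine (h1.sub ih).congr' ?_ EventuallyEq.rfl
    filter_upwards [eventually_gt_atTop 0] with t ht
    rw [show μ + 2 * ((k + 1 : ℕ) : ℝ) = μ + 2 * k + 2 by push_cast; ring, besselJ_add_two _ ht,
      pow_succ]
    ring

/-- The Wronskian `t * (J_a' * J_b - J_a * J_b')`, with derivatives eliminated. -/
noncomputable def besselWronskian (a b t : ℝ) : ℝ :=
  (a - b) * (besselJ a t * besselJ b t) -
    t * (besselJ (a + 1) t * besselJ b t - besselJ a t * besselJ (b + 1) t)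

theorem hasDerivAt_besselWronskian (a b : ℝ) {t : ℝ} (ht : 0 < t) :
    HasDerivAt (besselWronskian a b)
      ((a ^ 2 - b ^ 2) * (t⁻¹ * besselJ a t * besselJ b t)) t := by
  have ha := hasDerivAt_besselJ a ht
  have hb := hasDerivAt_besselJ b ht
  have ha' := hasDerivAt_besselJ_add_one a ht
  have hb' := hasDerivAt_besselJ_add_one b ht
  refine (((ha.mul hb).const_mul (a - b)).sub
    ((hasDerivAt_id t).mul ((ha'.mul hb).sub (ha.mul hb')))).congr_deriv ?_
  simp
  field_simp
  ring

theorem tendsto_besselWronskian_zero {a b : ℝ} (hab : 0 < a + b) :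
    Tendsto (besselWronskian a b) (𝓝[>] 0) (𝓝 0) := by
  have ht : Tendsto (fun t : ℝ => t) (𝓝[>] 0) (𝓝 0) := nhdsWithin_le_nhds
  have := ((tendsto_besselJ_mul_besselJ_zero hab).const_mul (a - b)).sub
    (ht.mul ((tendsto_besselJ_mul_besselJ_zero (show 0 < a + 1 + b by linarith)).sub
      (tendsto_besselJ_mul_besselJ_zero (show 0 < a + (b + 1) by linarith))))
  simp only [sub_self, mul_zero] at this
  exact this

theorem tendsto_besselWronskian_atTop (a : ℝ) (k : ℕ) :
    Tendsto (besselWronskian a (a + 2 * k)) atTop (𝓝 0) := by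
  have hJ := besselJ_isBigO
  have h1 : (fun t => besselJ a t * besselJ (a + 2 * k) t) =O[atTop] fun t : ℝ => t⁻¹ := by
    refine ((hJ a).mul (hJ (a + 2 * k))).congr' EventuallyEq.rfl ?_
    filter_upwards [eventually_gt_atTop 0] with t ht
    rw [← Real.rpow_neg_one, ← Real.rpow_add ht]
    norm_num
  have h2 : ∀ x y : ℝ, (fun t => t * (besselJ x t *
      (besselJ (y + 2 * k) t - (-1) ^ k * besselJ y t))) =O[atTop] fun t : ℝ => t⁻¹ := fun x y => by
    refine ((Asymptotics.isBigO_refl (fun t : ℝ => t) atTop).mul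
      ((hJ x).mul (besselJ_add_even_isBigO y k))).congr' EventuallyEq.rfl ?_
    filter_upwards [eventually_gt_atTop 0] with t ht
    rw [← Real.rpow_add ht]
    norm_num [Real.rpow_neg ht.le]
    field_simp
  refine Asymptotics.IsBigO.trans_tendsto ?_ tendsto_inv_atTop_zero
  refine ((h1.const_mul_left (a - (a + 2 * k))).sub
    ((h2 (a + 1) a).sub (h2 a (a + 1)))).congr_left fun t => ?_
  rw [besselWronskian, show a + 2 * (k : ℝ) + 1 = a + 1 + 2 * k by ring]
  ring

theorem integral_besselJ_mul_besselJ_add_even {a : ℝ} {k : ℕ} (hk : k ≠ 0) (ha : 0 < a + k) :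
    ∫ t in Ioi 0, t⁻¹ * besselJ a t * besselJ (a + 2 * k) t = 0 := by
  have hab : 0 < a + (a + 2 * k) := by linarith
  have h := integral_Ioi_eq_zero_of_hasDerivAt
    (fun t ht => hasDerivAt_besselWronskian a (a + 2 * k) ht)
    ((integrableOn_besselJ_mul_besselJ hab).const_mul _)
    (tendsto_besselWronskian_zero hab) (tendsto_besselWronskian_atTop a k)
  rw [integral_const_mul] at h
  refine (mul_eq_zero.1 h).resolve_left ?_
  have hk' : (k : ℝ) ≠ 0 := by exact_mod_cast hk
  have : a ^ 2 - (a + 2 * k) ^ 2 = -4 * (k * (a + k)) := by ring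
  rw [this]
  exact mul_ne_zero (by norm_num) (mul_ne_zero hk' ha.ne')

/-- The Laplace transform of a real function on `(0, ∞)`. -/
noncomputable def realLaplace (f : ℝ → ℝ) (s : ℝ) : ℝ :=
  ∫ t in Ioi 0, Real.exp (-(s * t)) * f t

theorem integrableOn_exp_mul_rpow {p s : ℝ} (hp : 0 < p) (hs : 0 < s) :
    IntegrableOn (fun t : ℝ => Real.exp (-(s * t)) * t ^ (p - 1)) (Ioi 0) := by
  refine (integrableOn_rpow_mul_exp_neg_mul_rpow (p := 1) (s := p - 1) (by linarith) one_pos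
    hs).congr_fun (fun t _ => ?_) measurableSet_Ioi
  simp [mul_comm]

theorem integral_exp_mul_rpow {p s : ℝ} (hp : 0 < p) (hs : 0 < s) :
    ∫ t in Ioi 0, Real.exp (-(s * t)) * t ^ (p - 1) = Real.Gamma p * s ^ (-p) := by
  simp_rw [mul_comm (Real.exp _)]
  rw [Real.integral_rpow_mul_exp_neg_mul_Ioi hp hs, one_div, Real.inv_rpow hs.le,
    Real.rpow_neg hs.le, mul_comm]

section
variable {f : ℝ → ℝ} {C p : ℝ}

theorem integrableOn_exp_mul (hf : Measurable f) (hp : 0 < p)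
    (hC : ∀ t, 0 < t → |f t| ≤ C * t ^ (p - 1)) {s : ℝ} (hs : 0 < s) :
    IntegrableOn (fun t => Real.exp (-(s * t)) * f t) (Ioi 0) := by
  refine Integrable.mono' ((integrableOn_exp_mul_rpow hp hs).const_mul C)
    (by fun_prop : Measurable _).aestronglyMeasurable ?_
  refine (ae_restrict_mem measurableSet_Ioi).mono fun t ht => ?_
  rw [Real.norm_eq_abs, abs_mul, Real.abs_exp, mul_left_comm]
  exact mul_le_mul_of_nonneg_left (hC t ht) (Real.exp_pos _).le

theorem abs_realLaplace_le (hp : 0 < p)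
    (hC : ∀ t, 0 < t → |f t| ≤ C * t ^ (p - 1)) {s : ℝ} (hs : 0 < s) :
    |realLaplace f s| ≤ C * Real.Gamma p * s ^ (-p) := by
  rw [mul_assoc, ← integral_exp_mul_rpow hp hs, ← integral_const_mul, ← Real.norm_eq_abs,
    realLaplace]
  refine norm_integral_le_of_norm_le ((integrableOn_exp_mul_rpow hp hs).const_mul C) ?_
  refine (ae_restrict_mem measurableSet_Ioi).mono fun t ht => ?_
  rw [Real.norm_eq_abs, abs_mul, Real.abs_exp, mul_left_comm]
  exact mul_le_mul_of_nonneg_left (hC t ht) (Real.exp_pos _).le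

theorem hasDerivAt_realLaplace (hf : Measurable f) (hp : 0 < p)
    (hC : ∀ t, 0 < t → |f t| ≤ C * t ^ (p - 1)) {s : ℝ} (hs : 0 < s) :
    HasDerivAt (realLaplace f) (-realLaplace (fun t => t * f t) s) s := by
  have hs2 : 0 < s / 2 := by positivity
  have h := (hasDerivAt_integral_of_dominated_loc_of_deriv_le (μ := volume.restrict (Ioi 0))
    (F := fun s t => Real.exp (-(s * t)) * f t)
    (F' := fun s t => -(Real.exp (-(s * t)) * (t * f t)))
    (bound := fun t => C * (Real.exp (-(s / 2 * t)) * t ^ (p + 1 - 1)))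
    (Ioi_mem_nhds (half_lt_self hs))
    (Eventually.of_forall fun x => (by fun_prop : Measurable _).aestronglyMeasurable)
    (integrableOn_exp_mul hf hp hC hs) (by fun_prop : Measurable _).aestronglyMeasurable
    ?_ ((integrableOn_exp_mul_rpow (by linarith) hs2).const_mul C) ?_).2
  · simp only [integral_neg] at h
    exact h
  · refine (ae_restrict_mem measurableSet_Ioi).mono fun t ht x hx => ?_
    have ht' : 0 < t := ht
    have hx' : s / 2 < x := hx
    rw [norm_neg, Real.norm_eq_abs, abs_mul, Real.abs_exp, abs_mul, abs_of_pos ht']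
    calc _ ≤ Real.exp (-(s / 2 * t)) * (t * (C * t ^ (p - 1))) := by
          gcongr
          exact hC t ht
      _ = _ := by
          rw [add_sub_right_comm, Real.rpow_add_one ht'.ne']
          ring
  · refine Eventually.of_forall fun t x _ => ?_
    refine ((((hasDerivAt_id x).mul_const t).neg.exp).mul_const (f t)).congr_deriv ?_
    simp
    ring

theorem mul_realLaplace_eq {f' : ℝ → ℝ} {s : ℝ} (hs : 0 < s) (hp : 0 < p)
    (hC : ∀ t, 0 < t → |f t| ≤ C * t ^ p) (hd : ∀ t, 0 < t → HasDerivAt f (f' t) t)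
    (hf : IntegrableOn (fun t => Real.exp (-(s * t)) * f t) (Ioi 0))
    (hf' : IntegrableOn (fun t => Real.exp (-(s * t)) * f' t) (Ioi 0)) :
    s * realLaplace f s = realLaplace f' s := by
  have hb : ∀ t ∈ Ioi (0 : ℝ), ‖Real.exp (-(s * t)) * f t‖ ≤
      C * (t ^ p * Real.exp (-s * t)) := fun t ht => by
    rw [Real.norm_eq_abs, abs_mul, Real.abs_exp, ← mul_assoc, mul_comm, neg_mul]
    exact mul_le_mul_of_nonneg_right (hC t ht) (Real.exp_pos _).le
  have h := integral_Ioi_eq_zero_of_hasDerivAt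
    (f := fun t => Real.exp (-(s * t)) * f t)
    (f' := fun t => Real.exp (-(s * t)) * f' t - s * (Real.exp (-(s * t)) * f t))
    (fun t ht => ?_) (hf'.sub (hf.const_mul s)) ?_ ?_
  · rw [integral_sub hf' (hf.const_mul s), integral_const_mul, sub_eq_zero] at h
    exact h.symm
  · refine ((((hasDerivAt_id t).const_mul s).neg.exp).mul (hd t ht)).congr_deriv ?_
    simp
    ring
  · refine squeeze_zero_norm' (eventually_mem_nhdsWithin.mono hb) ?_
    have : Continuous fun t : ℝ => C * (t ^ p * Real.exp (-s * t)) :=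
      ((Real.continuous_rpow_const hp.le).mul (by fun_prop)).const_mul C
    have := (this.tendsto 0).mono_left (nhdsWithin_le_nhds (s := Ioi 0))
    simpa [Real.zero_rpow hp.ne'] using this
  · refine squeeze_zero_norm' ((eventually_gt_atTop 0).mono hb) ?_
    simpa using (tendsto_rpow_mul_exp_neg_mul_atTop_nhds_zero p s hs).const_mul C

end

theorem tendsto_rpow_mul_realLaplace {g : ℝ → ℝ} {C p c : ℝ} (hg : Measurable g) (hp : 0 < p)
    (hC : ∀ t, 0 < t → |g t| ≤ C) (h0 : Tendsto g (𝓝[>] 0) (𝓝 c)) :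
    Tendsto (fun s => s ^ p * realLaplace (fun t => t ^ (p - 1) * g t) s) atTop
      (𝓝 (c * Real.Gamma p)) := by
  have h1 : ∀ s : ℝ, 0 < s → s ^ p * realLaplace (fun t => t ^ (p - 1) * g t) s =
      ∫ t in Ioi 0, Real.exp (-(1 * t)) * t ^ (p - 1) * g (s⁻¹ * t) := fun s hs => by
    have := integral_comp_mul_left_Ioi
      (fun t => Real.exp (-(s * t)) * (t ^ (p - 1) * g t)) 0 (inv_pos.2 hs)
    rw [mul_zero, inv_inv, smul_eq_mul] at this
    rw [← mul_div_cancel_left₀ (realLaplace _ s) hs.ne', realLaplace, ← this, mul_div_assoc',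
      ← div_mul_eq_mul_div, ← Real.rpow_sub_one hs.ne', ← integral_const_mul]
    refine setIntegral_congr_fun measurableSet_Ioi fun t ht => ?_
    have ht' : 0 ≤ t := le_of_lt ht
    rw [mul_inv_cancel_left₀ hs.ne', Real.mul_rpow (inv_pos.2 hs).le ht', Real.inv_rpow hs.le,
      one_mul]
    have : s ^ (p - 1) ≠ 0 := (Real.rpow_pos_of_pos hs _).ne'
    field_simp
  have h2 : c * Real.Gamma p = ∫ t in Ioi 0, Real.exp (-(1 * t)) * t ^ (p - 1) * c := by
    rw [integral_mul_const, integral_exp_mul_rpow hp one_pos, Real.one_rpow]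
    ring
  rw [h2]
  refine Tendsto.congr' ((eventually_gt_atTop 0).mono fun s hs => (h1 s hs).symm) ?_
  refine tendsto_integral_filter_of_dominated_convergence
    (fun t => Real.exp (-(1 * t)) * t ^ (p - 1) * C)
    (Eventually.of_forall fun s => (by fun_prop : Measurable _).aestronglyMeasurable) ?_
    ((integrableOn_exp_mul_rpow hp one_pos).mul_const C) ?_
  · filter_upwards [eventually_gt_atTop 0] with s hs
    refine (ae_restrict_mem measurableSet_Ioi).mono fun t ht => ?_
    have ht' : 0 < t := ht
    rw [norm_mul, Real.norm_of_nonneg (by positivity)]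
    gcongr
    exact hC _ (by positivity)
  · refine (ae_restrict_mem measurableSet_Ioi).mono fun t ht => ?_
    have ht' : 0 < t := ht
    refine (h0.comp ?_).const_mul _
    refine tendsto_nhdsWithin_iff.2 ⟨?_, ?_⟩
    · simpa using tendsto_inv_atTop_zero.mul_const t
    · filter_upwards [eventually_gt_atTop 0] with s hs
      exact mem_Ioi.2 (by positivity)

theorem tendsto_realLaplace_zero {f : ℝ → ℝ} (hf : IntegrableOn f (Ioi 0)) :
    Tendsto (realLaplace f) (𝓝[>] 0) (𝓝 (∫ t in Ioi 0, f t)) := by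
  refine tendsto_integral_filter_of_dominated_convergence (fun t => |f t|)
    (Eventually.of_forall fun s =>
      (by fun_prop : Continuous fun t => Real.exp (-(s * t))).aestronglyMeasurable.mul
        hf.aestronglyMeasurable) ?_ hf.abs ?_
  · filter_upwards [self_mem_nhdsWithin] with s hs
    refine (ae_restrict_mem measurableSet_Ioi).mono fun t ht => ?_
    have hs' : 0 < s := hs
    have ht' : 0 < t := ht
    rw [norm_mul, Real.norm_of_nonneg (Real.exp_pos _).le]
    refine mul_le_of_le_one_left (norm_nonneg _) (Real.exp_le_one_iff.2 ?_)
    have := mul_pos hs' ht'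
    linarith
  · refine Eventually.of_forall fun t => ?_
    have : Continuous fun s => Real.exp (-(s * t)) * f t := by fun_prop
    have := (this.tendsto 0).mono_left (nhdsWithin_le_nhds (s := Ioi 0))
    simpa using this

theorem eq_of_tendsto_of_hasDerivAt_zero {f : ℝ → ℝ} {a : ℝ}
    (hd : ∀ s, 0 < s → HasDerivAt f 0 s) (ha : Tendsto f atTop (𝓝 a)) :
    (∀ s, 0 < s → f s = a) := by
  obtain ⟨c, hc⟩ := isOpen_Ioi.exists_is_const_of_deriv_eq_zero isPreconnected_Ioi
    (fun s hs => (hd s hs).differentiableAt.differentiableWithinAt)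
    (fun s hs => (hd s hs).deriv)
  have : Tendsto f atTop (𝓝 c) :=
    tendsto_const_nhds.congr' ((eventually_gt_atTop 0).mono fun s hs => (hc s hs).symm)
  intro s hs
  rw [hc s hs, tendsto_nhds_unique this ha]

theorem hasDerivAt_sqrt_one_add_sq (s : ℝ) :
    HasDerivAt (fun s : ℝ => √(1 + s ^ 2)) (s / √(1 + s ^ 2)) s := by
  have h : 0 < 1 + s ^ 2 := by positivity
  refine (((hasDerivAt_pow 2 s).const_add 1).sqrt h.ne').congr_deriv ?_
  push_cast
  field_simp

theorem hasDerivAt_sqrt_one_add_sq_add_rpow (s : ℝ) (hs : 0 < s) (μ : ℝ) :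
    HasDerivAt (fun s : ℝ => (√(1 + s ^ 2) + s) ^ μ)
      (μ / √(1 + s ^ 2) * (√(1 + s ^ 2) + s) ^ μ) s := by
  have hq : 0 < √(1 + s ^ 2) := by positivity
  have hr : 0 < √(1 + s ^ 2) + s := by positivity
  refine (((hasDerivAt_sqrt_one_add_sq s).add (hasDerivAt_id s)).rpow_const
    (Or.inl hr.ne')).congr_deriv ?_
  simp only [Pi.add_apply, id]
  rw [Real.rpow_sub_one hr.ne']
  field_simp
  ring

section
variable {μ : ℝ}

theorem exists_abs_inv_mul_besselJ_le (hμ : 0 < μ) :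
    ∃ C, ∀ t, 0 < t → |t⁻¹ * besselJ μ t| ≤ C * t ^ (μ - 1) := by
  obtain ⟨C, hC, h⟩ := exists_abs_besselJ_le_rpow hμ.le
  refine ⟨C, fun t ht => ?_⟩
  rw [abs_mul, abs_inv, abs_of_pos ht, Real.rpow_sub_one ht.ne', mul_div_assoc', div_eq_inv_mul]
  gcongr
  exact h t ht

theorem exists_abs_mul_besselJ_le (hμ : 0 < μ) :
    ∃ C, ∀ t, 0 < t → |t * besselJ μ t| ≤ C * t ^ (μ + 1) := by
  obtain ⟨C, hC, h⟩ := exists_abs_besselJ_le_rpow hμ.le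
  refine ⟨C, fun t ht => ?_⟩
  rw [abs_mul, abs_of_pos ht, Real.rpow_add_one ht.ne', ← mul_assoc, mul_comm]
  gcongr
  exact h t ht

theorem integrableOn_exp_mul_inv_mul_besselJ (hμ : 0 < μ) {s : ℝ} (hs : 0 < s) :
    IntegrableOn (fun t => Real.exp (-(s * t)) * (t⁻¹ * besselJ μ t)) (Ioi 0) := by
  have := measurable_besselJ μ
  obtain ⟨C, h⟩ := exists_abs_inv_mul_besselJ_le hμ
  exact integrableOn_exp_mul (by fun_prop) hμ h hs

theorem integrableOn_exp_mul_besselJ (hμ : 0 < μ) {s : ℝ} (hs : 0 < s) :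
    IntegrableOn (fun t => Real.exp (-(s * t)) * besselJ μ t) (Ioi 0) := by
  obtain ⟨C, hC, h⟩ := exists_abs_besselJ_le_rpow hμ.le
  exact integrableOn_exp_mul (p := μ + 1) (measurable_besselJ μ) (by linarith) (by simpa using h) hs

theorem integrableOn_exp_mul_mul_besselJ (hμ : 0 < μ) {s : ℝ} (hs : 0 < s) :
    IntegrableOn (fun t => Real.exp (-(s * t)) * (t * besselJ μ t)) (Ioi 0) := by
  have := measurable_besselJ μ
  obtain ⟨C, h⟩ := exists_abs_mul_besselJ_le hμ
  exact integrableOn_exp_mul (p := μ + 1 + 1) (by fun_prop) (by linarith) (by simpa using h) hs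

theorem mul_realLaplace_besselJ (hμ : 0 < μ) {s : ℝ} (hs : 0 < s) :
    s * realLaplace (besselJ μ) s =
      μ * realLaplace (fun t => t⁻¹ * besselJ μ t) s - realLaplace (besselJ (μ + 1)) s := by
  obtain ⟨C, hC, h⟩ := exists_abs_besselJ_le_rpow hμ.le
  have i1 := (integrableOn_exp_mul_inv_mul_besselJ hμ hs).const_mul μ
  have i2 := integrableOn_exp_mul_besselJ (show 0 < μ + 1 by linarith) hs
  have e : (fun t => Real.exp (-(s * t)) * (μ / t * besselJ μ t - besselJ (μ + 1) t)) = fun t =>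
      μ * (Real.exp (-(s * t)) * (t⁻¹ * besselJ μ t)) - Real.exp (-(s * t)) * besselJ (μ + 1) t := by
    funext t; ring
  rw [mul_realLaplace_eq hs hμ h (fun t ht => hasDerivAt_besselJ μ ht)
    (integrableOn_exp_mul_besselJ hμ hs) (e ▸ i1.sub i2), realLaplace, e, integral_sub i1 i2,
    integral_const_mul]
  rfl

theorem mul_realLaplace_mul_besselJ (hμ : 0 < μ) {s : ℝ} (hs : 0 < s) :
    s * realLaplace (fun t => t * besselJ μ t) s =
      (μ + 1) * realLaplace (besselJ μ) s - realLaplace (fun t => t * besselJ (μ + 1) t) s := by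
  obtain ⟨C, h⟩ := exists_abs_mul_besselJ_le hμ
  have i1 := (integrableOn_exp_mul_besselJ hμ hs).const_mul (μ + 1)
  have i2 := integrableOn_exp_mul_mul_besselJ (show 0 < μ + 1 by linarith) hs
  have e : (fun t => Real.exp (-(s * t)) * ((μ + 1) * besselJ μ t - t * besselJ (μ + 1) t)) =
      fun t => (μ + 1) * (Real.exp (-(s * t)) * besselJ μ t) -
        Real.exp (-(s * t)) * (t * besselJ (μ + 1) t) := by
    funext t; ring
  rw [mul_realLaplace_eq (f' := fun t => (μ + 1) * besselJ μ t - t * besselJ (μ + 1) t) hs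
    (show 0 < μ + 1 by linarith) h (fun t ht => ?_)
    (integrableOn_exp_mul_mul_besselJ hμ hs) (e ▸ i1.sub i2), realLaplace, e, integral_sub i1 i2,
    integral_const_mul]
  · rfl
  · refine ((hasDerivAt_id t).mul (hasDerivAt_besselJ μ ht)).congr_deriv ?_
    simp
    field_simp
    ring

theorem mul_realLaplace_mul_besselJ_add_one (hμ : 0 < μ) {s : ℝ} (hs : 0 < s) :
    s * realLaplace (fun t => t * besselJ (μ + 1) t) s =
      realLaplace (fun t => t * besselJ μ t) s - μ * realLaplace (besselJ (μ + 1)) s := by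
  have hμ1 : 0 < μ + 1 := by linarith
  obtain ⟨C, h⟩ := exists_abs_mul_besselJ_le hμ1
  have i1 := (integrableOn_exp_mul_besselJ hμ1 hs).const_mul μ
  have i2 := integrableOn_exp_mul_mul_besselJ hμ hs
  have e : (fun t => Real.exp (-(s * t)) * (t * besselJ μ t - μ * besselJ (μ + 1) t)) =
      fun t => Real.exp (-(s * t)) * (t * besselJ μ t) -
        μ * (Real.exp (-(s * t)) * besselJ (μ + 1) t) := by
    funext t; ring
  rw [mul_realLaplace_eq (f' := fun t => t * besselJ μ t - μ * besselJ (μ + 1) t) hs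
    (show 0 < μ + 1 + 1 by linarith) h (fun t ht => ?_)
    (integrableOn_exp_mul_mul_besselJ hμ1 hs) (e ▸ i2.sub i1), realLaplace, e, integral_sub i2 i1,
    integral_const_mul]
  · rfl
  · refine ((hasDerivAt_id t).mul (hasDerivAt_besselJ_add_one μ ht)).congr_deriv ?_
    simp
    field_simp
    ring

/-- The Bessel equation on the Laplace side. -/
theorem realLaplace_besselJ_ode (hμ : 0 < μ) {s : ℝ} (hs : 0 < s) :
    (1 + s ^ 2) * realLaplace (fun t => t * besselJ μ t) s =
      s * realLaplace (besselJ μ) s + μ ^ 2 * realLaplace (fun t => t⁻¹ * besselJ μ t) s := by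
  linear_combination s * mul_realLaplace_mul_besselJ hμ hs -
    mul_realLaplace_mul_besselJ_add_one hμ hs + μ * mul_realLaplace_besselJ hμ hs

theorem hasDerivAt_realLaplace_inv_mul_besselJ (hμ : 0 < μ) {s : ℝ} (hs : 0 < s) :
    HasDerivAt (realLaplace fun t => t⁻¹ * besselJ μ t) (-realLaplace (besselJ μ) s) s := by
  have := measurable_besselJ μ
  obtain ⟨C, h⟩ := exists_abs_inv_mul_besselJ_le hμ
  refine (hasDerivAt_realLaplace (by fun_prop) hμ h hs).congr_deriv ?_
  rw [neg_inj]
  refine setIntegral_congr_fun measurableSet_Ioi fun t ht => ?_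
  simp only
  rw [mul_inv_cancel_left₀ (ne_of_gt ht)]

theorem hasDerivAt_realLaplace_besselJ (hμ : 0 < μ) {s : ℝ} (hs : 0 < s) :
    HasDerivAt (realLaplace (besselJ μ)) (-realLaplace (fun t => t * besselJ μ t) s) s := by
  obtain ⟨C, hC, h⟩ := exists_abs_besselJ_le_rpow hμ.le
  exact hasDerivAt_realLaplace (p := μ + 1) (measurable_besselJ μ) (by linarith)
    (by simpa using h) hs

theorem sqrt_one_add_sq_le {s : ℝ} (hs : 0 ≤ s) : √(1 + s ^ 2) ≤ 1 + s := by
  rw [Real.sqrt_le_left (by linarith)]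
  nlinarith

theorem sqrt_mul_realLaplace_besselJ (hμ : 0 < μ) {s : ℝ} (hs : 0 < s) :
    √(1 + s ^ 2) * realLaplace (besselJ μ) s = μ * realLaplace (fun t => t⁻¹ * besselJ μ t) s := by
  set L := realLaplace fun t => t⁻¹ * besselJ μ t with hL
  set A := realLaplace (besselJ μ) with hA
  let M : ℝ → ℝ := fun s => (μ * L s - √(1 + s ^ 2) * A s) * (√(1 + s ^ 2) + s) ^ (-μ)
  have hd : ∀ s, 0 < s → HasDerivAt M 0 s := fun s hs => by
    have h := ((((hasDerivAt_realLaplace_inv_mul_besselJ hμ hs).const_mul μ).sub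
      ((hasDerivAt_sqrt_one_add_sq s).mul (hasDerivAt_realLaplace_besselJ hμ hs))).mul
        (hasDerivAt_sqrt_one_add_sq_add_rpow s hs (-μ)))
    refine h.congr_deriv ?_
    have hode := realLaplace_besselJ_ode hμ hs
    have hq : 0 < √(1 + s ^ 2) := by positivity
    have hq2 : √(1 + s ^ 2) ^ 2 = 1 + s ^ 2 := Real.sq_sqrt (by positivity)
    rw [← hq2, ← hL, ← hA] at hode
    simp only [Pi.sub_apply, Pi.mul_apply, ← hL, ← hA]
    field_simp
    linear_combination (√(1 + s ^ 2) + s) ^ (-μ) * hode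
  have ht : Tendsto M atTop (𝓝 0) := by
    obtain ⟨C, h⟩ := exists_abs_inv_mul_besselJ_le hμ
    obtain ⟨D, hD, h'⟩ := exists_abs_besselJ_le_rpow hμ.le
    have hlim := ((tendsto_rpow_neg_atTop hμ).const_mul
      (μ * (C * Real.Gamma μ) + 2 * (D * Real.Gamma (μ + 1))))
    rw [mul_zero] at hlim
    refine squeeze_zero_norm' ?_ hlim
    filter_upwards [eventually_ge_atTop 1] with s hs
    have hs0 : 0 < s := by linarith
    have h1 := abs_realLaplace_le hμ h hs0
    have h2 := abs_realLaplace_le (p := μ + 1) (by linarith) (by simpa using h') hs0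
    have hq : √(1 + s ^ 2) ≤ 2 * s := (sqrt_one_add_sq_le hs0.le).trans (by linarith)
    have h3 : (√(1 + s ^ 2) + s) ^ (-μ) ≤ 1 :=
      Real.rpow_le_one_of_one_le_of_nonpos (by linarith [Real.sqrt_nonneg (1 + s ^ 2)])
        (by linarith)
    have h4 : 0 ≤ (√(1 + s ^ 2) + s) ^ (-μ) := by positivity
    rw [Real.norm_eq_abs, abs_mul, abs_of_nonneg h4]
    refine (mul_le_of_le_one_right (abs_nonneg _) h3).trans ((abs_sub _ _).trans ?_)
    rw [abs_mul, abs_mul, abs_of_pos hμ, abs_of_nonneg (Real.sqrt_nonneg _)]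
    calc μ * |L s| + √(1 + s ^ 2) * |A s| ≤ μ * (C * Real.Gamma μ * s ^ (-μ)) +
          2 * s * (D * Real.Gamma (μ + 1) * s ^ (-(μ + 1))) := by gcongr
      _ = _ := by
          rw [neg_add, ← sub_eq_add_neg, Real.rpow_sub_one hs0.ne']
          field_simp
  have h0 := eq_of_tendsto_of_hasDerivAt_zero hd ht s hs
  have h4 : (√(1 + s ^ 2) + s) ^ (-μ) ≠ 0 := by positivity
  linarith [(mul_eq_zero.1 h0).resolve_right h4]

theorem tendsto_rpow_mul_realLaplace_inv_mul_besselJ (hμ : 0 < μ) :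
    Tendsto (fun s => s ^ μ * realLaplace (fun t => t⁻¹ * besselJ μ t) s) atTop
      (𝓝 ((1 / 2) ^ μ / μ)) := by
  obtain ⟨C, hC, h⟩ := exists_abs_besselJ_le_rpow hμ.le
  have hG := (Real.Gamma_pos_of_pos hμ).ne'
  have e : ∀ t : ℝ, 0 < t →
      t⁻¹ * besselJ μ t = t ^ (μ - 1) * ((1 / 2) ^ μ * besselEntire μ (t ^ 2 / 4)) := fun t ht => by
    rw [besselJ_eq, Real.rpow_sub_one ht.ne', div_eq_mul_one_div t 2,
      Real.mul_rpow ht.le (by norm_num)]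
    ring
  have hcont : Continuous fun t => (1 / 2 : ℝ) ^ μ * besselEntire μ (t ^ 2 / 4) :=
    ((continuous_besselEntire μ).comp (by fun_prop)).const_mul _
  have h0 := (hcont.tendsto 0).mono_left (nhdsWithin_le_nhds (s := Ioi 0))
  rw [zero_pow two_ne_zero, zero_div, besselEntire_zero, Real.Gamma_add_one hμ.ne'] at h0
  have := tendsto_rpow_mul_realLaplace (C := C) hcont.measurable hμ (fun t ht => ?_) h0
  · convert this using 2 with s
    · congr 1
      refine setIntegral_congr_fun measurableSet_Ioi fun t ht => ?_
      simp only [e t ht]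
    · field_simp
  · have ht' : 0 < t ^ μ := Real.rpow_pos_of_pos ht _
    have h1 := h t ht
    rw [besselJ_eq, div_eq_mul_one_div t 2, Real.mul_rpow ht.le (by norm_num), mul_assoc, abs_mul,
      abs_of_pos ht', mul_comm] at h1
    exact le_of_mul_le_mul_right h1 ht'

theorem integral_inv_mul_besselJ (hμ : 0 < μ) : ∫ t in Ioi 0, t⁻¹ * besselJ μ t = 1 / μ := by
  set L := realLaplace fun t => t⁻¹ * besselJ μ t with hL
  have hd : ∀ s, 0 < s → HasDerivAt (fun s => L s * (√(1 + s ^ 2) + s) ^ μ) 0 s := fun s hs => by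
    refine ((hasDerivAt_realLaplace_inv_mul_besselJ hμ hs).mul
      (hasDerivAt_sqrt_one_add_sq_add_rpow s hs μ)).congr_deriv ?_
    have hq : 0 < √(1 + s ^ 2) := by positivity
    have h := sqrt_mul_realLaplace_besselJ hμ hs
    rw [← hL] at h ⊢
    field_simp
    linear_combination -(√(1 + s ^ 2) + s) ^ μ * h
  have ht : Tendsto (fun s => L s * (√(1 + s ^ 2) + s) ^ μ) atTop (𝓝 (1 / μ)) := by
    have h1 : Tendsto (fun s : ℝ => (√(1 + s ^ 2) + s) / s) atTop (𝓝 2) := by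
      have : Tendsto (fun s : ℝ => 2 + s⁻¹) atTop (𝓝 2) := by
        simpa using tendsto_inv_atTop_zero.const_add (2 : ℝ)
      refine tendsto_of_tendsto_of_tendsto_of_le_of_le' tendsto_const_nhds this ?_ ?_
      · filter_upwards [eventually_gt_atTop 0] with s hs
        rw [le_div_iff₀ hs]
        have : s ≤ √(1 + s ^ 2) := Real.le_sqrt_of_sq_le (by linarith)
        linarith
      · filter_upwards [eventually_gt_atTop 0] with s hs
        rw [div_le_iff₀ hs, add_mul, inv_mul_cancel₀ hs.ne']
        linarith [sqrt_one_add_sq_le hs.le]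
    have h2 := (tendsto_rpow_mul_realLaplace_inv_mul_besselJ hμ).mul
      (h1.rpow_const (p := μ) (Or.inl two_ne_zero))
    rw [div_mul_eq_mul_div, ← Real.mul_rpow (by norm_num) (by norm_num)] at h2
    norm_num at h2
    rw [one_div]
    refine h2.congr' ?_
    filter_upwards [eventually_gt_atTop 0] with s hs
    rw [Real.div_rpow (by positivity) hs.le]
    have : s ^ μ ≠ 0 := (Real.rpow_pos_of_pos hs _).ne'
    rw [← hL]
    field_simp
  have hconst := eq_of_tendsto_of_hasDerivAt_zero hd ht
  have hc : Tendsto (fun s : ℝ => (√(1 + s ^ 2) + s) ^ μ) (𝓝[>] 0) (𝓝 1) := by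
    have : Continuous fun s : ℝ => (√(1 + s ^ 2) + s) ^ μ :=
      (Real.continuous_rpow_const hμ.le).comp (by fun_prop)
    simpa using (this.tendsto 0).mono_left (nhdsWithin_le_nhds (s := Ioi 0))
  have h1 := (tendsto_realLaplace_zero (integrableOn_inv_mul_besselJ hμ)).mul hc
  rw [mul_one] at h1
  refine tendsto_nhds_unique h1 (tendsto_const_nhds.congr' ?_)
  filter_upwards [self_mem_nhdsWithin] with s hs
  exact (hconst s hs).symm

end

/-- The Chu–Vandermonde identity for reciprocals of Gamma values. -/
theorem sum_antidiagonal_choose_mul_inv_Gamma (k : ℕ) {a b : ℝ} (ha : 0 < a) (hb : 0 < b) :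
    ∑ p ∈ Finset.HasAntidiagonal.antidiagonal k, (k.choose p.1 : ℝ) *
        (Real.Gamma (a + p.1 + 1) * Real.Gamma (b + p.2 + 1))⁻¹ =
      Real.Gamma (a + b + 2 * k + 1) / (Real.Gamma (a + k + 1) * Real.Gamma (b + k + 1) *
        Real.Gamma (a + b + k + 1)) := by
  induction k generalizing a b with
  | zero =>
    have h : Real.Gamma (a + b + 1) ≠ 0 := (Real.Gamma_pos_of_pos (by positivity)).ne'
    simp
    field_simp
  | succ k ih =>
    have e (p : ℕ × ℕ) (hp : p ∈ Finset.HasAntidiagonal.antidiagonal k) :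
        (k.choose p.2 : ℝ) * (Real.Gamma (a + (p.1 + 1 : ℕ) + 1) * Real.Gamma (b + p.2 + 1))⁻¹ =
        (k.choose p.1 : ℝ) * (Real.Gamma (a + 1 + p.1 + 1) * Real.Gamma (b + p.2 + 1))⁻¹ := by
      rw [← Finset.HasAntidiagonal.mem_antidiagonal.1 hp, ← Nat.choose_symm_add]
      push_cast
      ring_nf
    have e' (p : ℕ × ℕ) :
        (k.choose p.1 : ℝ) * (Real.Gamma (a + p.1 + 1) * Real.Gamma (b + (p.2 + 1 : ℕ) + 1))⁻¹ =
        (k.choose p.1 : ℝ) * (Real.Gamma (a + p.1 + 1) * Real.Gamma (b + 1 + p.2 + 1))⁻¹ := by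
      push_cast
      ring_nf
    rw [Finset.sum_antidiagonal_choose_succ_mul
      (fun i j : ℕ => (Real.Gamma (a + i + 1) * Real.Gamma (b + j + 1))⁻¹), Finset.sum_congr rfl e]
    simp only [e']
    rw [ih ha (show 0 < b + 1 by linarith), ih (show 0 < a + 1 by linarith) hb]
    have hA : 0 < a + k + 1 := by positivity
    have hB : 0 < b + k + 1 := by positivity
    have hD : 0 < a + b + k + 1 + 1 := by positivity
    have hN : 0 < a + b + 2 * k + 1 + 1 := by positivity
    push_cast
    rw [show a + (b + 1) + 2 * k + 1 = a + b + 2 * k + 1 + 1 by ring,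
      show a + 1 + b + 2 * k + 1 = a + b + 2 * k + 1 + 1 by ring,
      show a + b + 2 * ((k : ℝ) + 1) + 1 = a + b + 2 * k + 1 + 1 + 1 by ring,
      show b + 1 + (k : ℝ) + 1 = b + k + 1 + 1 by ring,
      show a + 1 + (k : ℝ) + 1 = a + k + 1 + 1 by ring,
      show a + ((k : ℝ) + 1) + 1 = a + k + 1 + 1 by ring,
      show b + ((k : ℝ) + 1) + 1 = b + k + 1 + 1 by ring,
      show a + (b + 1) + (k : ℝ) + 1 = a + b + k + 1 + 1 by ring,
      show a + 1 + b + (k : ℝ) + 1 = a + b + k + 1 + 1 by ring,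
      show a + b + ((k : ℝ) + 1) + 1 = a + b + k + 1 + 1 by ring,
      Real.Gamma_add_one hA.ne', Real.Gamma_add_one hB.ne', Real.Gamma_add_one hN.ne']
    have := (Real.Gamma_pos_of_pos hA).ne'
    have := (Real.Gamma_pos_of_pos hB).ne'
    have := (Real.Gamma_pos_of_pos hD).ne'
    field_simp
    ring

theorem besselCoeff_mul_besselCoeff (a b : ℝ) (i j : ℕ) :
    besselCoeff a i * besselCoeff b j = (-1) ^ (i + j) / ((i + j).factorial : ℝ) *
      (((i + j).choose i : ℝ) * (Real.Gamma (a + i + 1) * Real.Gamma (b + j + 1))⁻¹) := by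
  have h : (((i + j).factorial : ℕ) : ℝ) = (i + j).choose i * i.factorial * j.factorial := by
    rw [Nat.choose_symm_add]
    exact_mod_cast (Nat.add_choose_mul_factorial_mul_factorial i j).symm
  have hc : ((i + j).choose i : ℝ) ≠ 0 := by
    exact_mod_cast (Nat.choose_pos (Nat.le_add_right i j)).ne'
  rw [h, pow_add, besselCoeff, besselCoeff]
  simp only [div_eq_mul_inv, mul_inv]
  field_simp

theorem besselEntire_mul_besselEntire {a b : ℝ} (ha : 0 < a) (hb : 0 < b) (x : ℝ) :
    besselEntire a x * besselEntire b x = ∑' k : ℕ, besselCoeff (a + b) k *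
      (Real.Gamma (a + b + 2 * k + 1) / (Real.Gamma (a + k + 1) * Real.Gamma (b + k + 1))) *
        x ^ k := by
  rw [besselEntire, besselEntire, tsum_mul_tsum_eq_tsum_sum_antidiagonal_of_summable_norm
    (f := fun k => besselCoeff a k * x ^ k) (g := fun k => besselCoeff b k * x ^ k)
    (summable_abs_besselCoeff_mul_pow a x) (summable_abs_besselCoeff_mul_pow b x)]
  congr 1
  funext k
  have e (p : ℕ × ℕ) (hp : p ∈ Finset.HasAntidiagonal.antidiagonal k) :
      besselCoeff a p.1 * x ^ p.1 * (besselCoeff b p.2 * x ^ p.2) =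
        (-1) ^ k / (k.factorial : ℝ) * x ^ k * ((k.choose p.1 : ℝ) *
          (Real.Gamma (a + p.1 + 1) * Real.Gamma (b + p.2 + 1))⁻¹) := by
    rw [mul_mul_mul_comm, besselCoeff_mul_besselCoeff, ← pow_add,
      Finset.HasAntidiagonal.mem_antidiagonal.1 hp]
    ring
  rw [Finset.sum_congr rfl e, ← Finset.mul_sum, sum_antidiagonal_choose_mul_inv_Gamma k ha hb,
    besselCoeff]
  simp only [div_eq_mul_inv, mul_inv]
  ring

theorem integrableOn_rpow_mul_one_sub_rpow {α β : ℝ} (hα : 0 < α) (hβ : 0 < β) :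
    IntegrableOn (fun x : ℝ => x ^ (α - 1) * (1 - x) ^ (β - 1)) (Ioo 0 1) := by
  have h := Complex.betaIntegral_convergent (u := α) (v := β) (by simpa) (by simpa)
  rw [intervalIntegrable_iff_integrableOn_Ioo_of_le (by simp)] at h
  refine IntegrableOn.congr_fun h.re (fun x hx => ?_) measurableSet_Ioo
  have hx0 := hx.1
  have hx1 := hx.2
  norm_cast
  rw [← Complex.ofReal_cpow, ← Complex.ofReal_cpow, RCLike.re_to_complex,
    Complex.re_mul_ofReal, Complex.ofReal_re]
  all_goals linarith

theorem integral_rpow_mul_one_sub_rpow {α β : ℝ} (hα : 0 < α) (hβ : 0 < β) :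
    ∫ x in Ioo (0 : ℝ) 1, x ^ (α - 1) * (1 - x) ^ (β - 1) = ProbabilityTheory.beta α β := by
  have h := Complex.betaIntegral_convergent (u := α) (v := β) (by simpa) (by simpa)
  rw [intervalIntegrable_iff_integrableOn_Ioo_of_le (by simp)] at h
  rw [ProbabilityTheory.beta_eq_betaIntegralReal α β hα hβ, Complex.betaIntegral,
    intervalIntegral.integral_of_le (by norm_num), integral_Ioc_eq_integral_Ioo,
    ← RCLike.re_to_complex, ← integral_re h]
  refine setIntegral_congr_fun measurableSet_Ioo fun x hx => ?_
  have hx0 := hx.1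
  have hx1 := hx.2
  norm_cast
  rw [← Complex.ofReal_cpow, ← Complex.ofReal_cpow, RCLike.re_to_complex,
    Complex.re_mul_ofReal, Complex.ofReal_re]
  all_goals linarith

/-- The (unnormalized) density of the arcsine distribution on `(0, 1)`. -/
noncomputable def arcsineWeight (x : ℝ) : ℝ := x ^ (-(1 / 2) : ℝ) * (1 - x) ^ (-(1 / 2) : ℝ)

theorem arcsineWeight_nonneg {x : ℝ} (hx : x ∈ Ioo (0 : ℝ) 1) : 0 ≤ arcsineWeight x :=
  mul_nonneg (Real.rpow_nonneg hx.1.le _) (Real.rpow_nonneg (by linarith [hx.2]) _)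

theorem measurable_arcsineWeight : Measurable arcsineWeight := by
  unfold arcsineWeight
  fun_prop

theorem rpow_mul_arcsineWeight {a x : ℝ} (hx : 0 < x) :
    x ^ a * arcsineWeight x = x ^ (a + 1 / 2 - 1) * (1 - x) ^ ((1 / 2 : ℝ) - 1) := by
  rw [arcsineWeight, ← mul_assoc, ← Real.rpow_add hx]
  ring_nf

theorem integrableOn_rpow_mul_arcsineWeight {a : ℝ} (ha : 0 ≤ a) :
    IntegrableOn (fun x => x ^ a * arcsineWeight x) (Ioo 0 1) :=
  (integrableOn_rpow_mul_one_sub_rpow (show 0 < a + 1 / 2 by positivity) one_half_pos).congr_fun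
    (fun _ hx => (rpow_mul_arcsineWeight hx.1).symm) measurableSet_Ioo

theorem integral_rpow_mul_arcsineWeight {a : ℝ} (ha : 0 ≤ a) :
    ∫ x in Ioo (0 : ℝ) 1, x ^ a * arcsineWeight x =
      Real.pi * (1 / 2) ^ (2 * a) * Real.Gamma (2 * a + 1) / Real.Gamma (a + 1) ^ 2 := by
  rw [setIntegral_congr_fun measurableSet_Ioo fun _ hx => rpow_mul_arcsineWeight hx.1,
    integral_rpow_mul_one_sub_rpow (show 0 < a + 1 / 2 by positivity) one_half_pos,
    ProbabilityTheory.beta, Real.Gamma_one_half_eq]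
  have h := Real.Gamma_mul_Gamma_add_half (a + 1 / 2)
  rw [show a + 1 / 2 + 1 / 2 = a + 1 by ring, show 2 * (a + 1 / 2) = 2 * a + 1 by ring,
    show 1 - (2 * a + 1) = -(2 * a) by ring, Real.rpow_neg two_pos.le, ← Real.inv_rpow two_pos.le,
    ← one_div] at h
  have hG : 0 < Real.Gamma (a + 1) := Real.Gamma_pos_of_pos (by positivity)
  rw [show a + 1 / 2 + 1 / 2 = a + 1 by ring, div_eq_div_iff hG.ne' (by positivity)]
  have hpi := Real.mul_self_sqrt Real.pi_pos.le
  linear_combination √Real.pi * Real.Gamma (a + 1) * h +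
    Real.Gamma (2 * a + 1) * (1 / 2) ^ (2 * a) * Real.Gamma (a + 1) * hpi

theorem integrableOn_arcsineWeight : IntegrableOn arcsineWeight (Ioo 0 1) := by
  simpa using integrableOn_rpow_mul_arcsineWeight le_rfl

theorem integral_arcsineWeight : ∫ x in Ioo (0 : ℝ) 1, arcsineWeight x = Real.pi := by
  simpa using integral_rpow_mul_arcsineWeight le_rfl

section
variable {a : ℝ}

theorem besselJ_two_mul_mul_sqrt {t x : ℝ} (ht : 0 < t) (hx : 0 < x) :
    besselJ (2 * a) (2 * √x * t) =
      ∑' k : ℕ, t ^ (2 * a) * besselCoeff (2 * a) k * t ^ (2 * k) * x ^ (a + k) := by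
  rw [besselJ_eq, mul_assoc, mul_div_cancel_left₀ _ two_ne_zero, besselEntire, ← tsum_mul_left]
  congr 1
  funext k
  rw [Real.mul_rpow (Real.sqrt_nonneg x) ht.le, Real.rpow_mul (Real.sqrt_nonneg x), Real.rpow_two,
    Real.sq_sqrt hx.le, Real.rpow_add_natCast hx.ne', mul_pow, mul_pow, Real.sq_sqrt hx.le, pow_mul]
  rw [show (2 : ℝ) ^ 2 * (x * t ^ 2) / 4 = x * t ^ 2 by ring, mul_pow]
  ring

/-- Neumann's formula for the square of a Bessel function. -/
theorem integral_besselJ_two_mul_mul_arcsineWeight (ha : 0 < a) {t : ℝ} (ht : 0 < t) :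
    ∫ x in Ioo (0 : ℝ) 1, besselJ (2 * a) (2 * √x * t) * arcsineWeight x =
      Real.pi * besselJ a t ^ 2 := by
  let c (k : ℕ) : ℝ := t ^ (2 * a) * besselCoeff (2 * a) k * t ^ (2 * k)
  have hi (k : ℕ) : IntegrableOn (fun x => c k * (x ^ (a + k) * arcsineWeight x)) (Ioo 0 1) :=
    (integrableOn_rpow_mul_arcsineWeight (by positivity)).const_mul (c k)
  have hs : Summable fun k : ℕ =>
      ∫ x in Ioo (0 : ℝ) 1, ‖c k * (x ^ (a + k) * arcsineWeight x)‖ := by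
    refine Summable.of_nonneg_of_le (fun k => by positivity) (fun k => ?_)
      (((summable_abs_besselCoeff_mul_pow (2 * a) (t ^ 2)).mul_left (t ^ (2 * a))).mul_right
        Real.pi)
    rw [← integral_arcsineWeight, ← integral_const_mul]
    refine setIntegral_mono_on (hi k).norm (integrableOn_arcsineWeight.const_mul _)
      measurableSet_Ioo fun x hx => ?_
    have hw := arcsineWeight_nonneg hx
    have hx1 : x ^ (a + k) ≤ 1 := Real.rpow_le_one hx.1.le hx.2.le (by positivity)
    have hx0 : 0 ≤ x ^ (a + k) := Real.rpow_nonneg hx.1.le _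
    have hc : |c k| = t ^ (2 * a) * |besselCoeff (2 * a) k * (t ^ 2) ^ k| := by
      simp only [c]
      rw [mul_assoc, abs_mul, abs_of_pos (Real.rpow_pos_of_pos ht _), pow_mul]
    rw [Real.norm_eq_abs, abs_mul, hc, abs_of_nonneg (mul_nonneg hx0 hw)]
    gcongr
    exact mul_le_of_le_one_left hw hx1
  have h := hasSum_integral_of_summable_integral_norm hi hs
  rw [setIntegral_congr_fun (g := fun x => besselJ (2 * a) (2 * √x * t) * arcsineWeight x)
    measurableSet_Ioo fun x hx => ?_] at h
  · rw [← h.tsum_eq, besselJ_eq, mul_pow, sq (besselEntire _ _),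
      besselEntire_mul_besselEntire ha ha, ← mul_assoc, ← tsum_mul_left]
    congr 1
    funext k
    rw [integral_const_mul, integral_rpow_mul_arcsineWeight (by positivity), ← two_mul]
    simp only [c]
    rw [div_eq_mul_one_div t 2, Real.mul_rpow ht.le (by norm_num), mul_add, mul_pow,
      Real.rpow_add (by norm_num), mul_comm 2 a, Real.rpow_mul ht.le,
      Real.rpow_mul (by norm_num) a, Real.rpow_two, Real.rpow_two]
    have : (1 / 2 : ℝ) ^ (2 * (k : ℝ)) = (1 / 4) ^ k := by
      rw [Real.rpow_mul (by norm_num), Real.rpow_natCast]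
      norm_num
    rw [this, div_eq_mul_one_div (t ^ 2) 4, mul_pow, pow_mul]
    ring
  · simp only
    rw [besselJ_two_mul_mul_sqrt ht hx.1, ← tsum_mul_right]
    simp only [c, mul_assoc]

theorem integral_inv_mul_comp_mul_left {f : ℝ → ℝ} {c : ℝ} (hc : 0 < c) :
    ∫ t in Ioi 0, t⁻¹ * f (c * t) = ∫ t in Ioi 0, t⁻¹ * f t := by
  have h := integral_comp_mul_left_Ioi' (fun t => t⁻¹ * f t) 0 hc
  rw [mul_zero, smul_eq_mul, ← integral_const_mul] at h
  rw [← h]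
  congr 1
  funext t
  rw [mul_inv]
  field_simp

theorem integrable_inv_mul_besselJ_mul_arcsineWeight (ha : 0 < a) :
    Integrable (fun p : ℝ × ℝ => p.1⁻¹ * besselJ (2 * a) (2 * √p.2 * p.1) * arcsineWeight p.2)
      ((volume.restrict (Ioi 0)).prod (volume.restrict (Ioo 0 1))) := by
  have hJ := measurable_besselJ (2 * a)
  have hw := measurable_arcsineWeight
  have ha2 : 0 < 2 * a := by positivity
  have hm : Measurable fun p : ℝ × ℝ =>
      p.1⁻¹ * besselJ (2 * a) (2 * √p.2 * p.1) * arcsineWeight p.2 := by fun_prop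
  refine (integrable_prod_iff' hm.aestronglyMeasurable).2 ⟨?_, ?_⟩
  · refine (ae_restrict_mem measurableSet_Ioo).mono fun x hx => ?_
    have hc : 0 < 2 * √x := mul_pos two_pos (Real.sqrt_pos.2 hx.1)
    have h := (integrableOn_Ioi_comp_mul_left_iff (fun t => t⁻¹ * besselJ (2 * a) t) 0 hc).2
      (by simpa using integrableOn_inv_mul_besselJ ha2)
    refine ((h.const_mul (2 * √x)).mul_const (arcsineWeight x)).congr (ae_of_all _ fun t => ?_)
    simp only
    rw [mul_inv, mul_assoc (2 * √x)⁻¹, mul_inv_cancel_left₀ hc.ne']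
  · refine IntegrableOn.congr_fun (integrableOn_arcsineWeight.const_mul
      (∫ t in Ioi 0, t⁻¹ * |besselJ (2 * a) t|)) (fun x hx => ?_) measurableSet_Ioo
    have hc : 0 < 2 * √x := mul_pos two_pos (Real.sqrt_pos.2 hx.1)
    simp only
    rw [← integral_inv_mul_comp_mul_left hc, ← integral_mul_const]
    refine setIntegral_congr_fun measurableSet_Ioi fun t ht => ?_
    simp only [Real.norm_eq_abs, abs_mul, abs_inv, abs_of_pos (mem_Ioi.1 ht),
      abs_of_nonneg (arcsineWeight_nonneg hx)]

theorem integral_inv_mul_besselJ_mul_self (ha : 0 < a) :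
    ∫ t in Ioi 0, t⁻¹ * besselJ a t * besselJ a t = 1 / (2 * a) := by
  have h := integral_integral_swap
    (f := fun t x => t⁻¹ * besselJ (2 * a) (2 * √x * t) * arcsineWeight x)
    (integrable_inv_mul_besselJ_mul_arcsineWeight ha)
  have hl : ∫ t in Ioi 0, ∫ x in Ioo (0 : ℝ) 1,
      t⁻¹ * besselJ (2 * a) (2 * √x * t) * arcsineWeight x =
        Real.pi * ∫ t in Ioi 0, t⁻¹ * besselJ a t * besselJ a t := by
    rw [← integral_const_mul]
    refine setIntegral_congr_fun measurableSet_Ioi fun t ht => ?_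
    simp only [mul_assoc (t⁻¹)]
    rw [integral_const_mul, integral_besselJ_two_mul_mul_arcsineWeight ha ht]
    ring
  have hr : ∫ x in Ioo (0 : ℝ) 1, ∫ t in Ioi 0,
      t⁻¹ * besselJ (2 * a) (2 * √x * t) * arcsineWeight x = 1 / (2 * a) * Real.pi := by
    rw [← integral_arcsineWeight, ← integral_const_mul]
    refine setIntegral_congr_fun measurableSet_Ioo fun x hx => ?_
    have hc : 0 < 2 * √x := mul_pos two_pos (Real.sqrt_pos.2 hx.1)
    rw [integral_mul_const, integral_inv_mul_comp_mul_left hc,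
      integral_inv_mul_besselJ (by positivity)]
  rw [hl, hr, mul_comm] at h
  exact mul_right_cancel₀ Real.pi_ne_zero h

end

theorem integral_besselJ_mul_besselJ_of_lt {ν : ℝ} {ℓ m : ℕ} (h : ν + ℓ + m > -1) (hlt : ℓ < m) :
    ∫ t in Ioi 0, t⁻¹ * besselJ (ν + 2 * ℓ + 1) t * besselJ (ν + 2 * m + 1) t = 0 := by
  obtain ⟨k, rfl⟩ := Nat.exists_eq_add_of_lt hlt
  have := integral_besselJ_mul_besselJ_add_even (a := ν + 2 * ℓ + 1) (Nat.succ_ne_zero k)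
    (by push_cast at h ⊢; linarith)
  rwa [show ν + 2 * ℓ + 1 + 2 * (k.succ : ℕ) = ν + 2 * (ℓ + k + 1 : ℕ) + 1 by push_cast; ring]
    at this

/-- For `ν ∈ ℝ` and `ℓ, m ∈ ℕ₀` with `ν+ℓ+m > -1`,
`∫_0^∞ t⁻¹ J_{ν+2ℓ+1}(t) J_{ν+2m+1}(t) dt = δ_{ℓ,m} / (2(2ℓ+ν+1))`. -/
theorem besselJ_orthogonality (ν : ℝ) (ℓ m : ℕ) (h : ν + ℓ + m > -1) :
    ∫ t in Set.Ioi (0 : ℝ),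
        t⁻¹ * besselJ (ν + 2 * ℓ + 1) t * besselJ (ν + 2 * m + 1) t =
      (if ℓ = m then 1 else 0) / (2 * (2 * ℓ + ν + 1)) := by
  rcases lt_trichotomy ℓ m with hlt | rfl | hlt
  · rw [if_neg hlt.ne, zero_div, integral_besselJ_mul_besselJ_of_lt h hlt]
  · rw [if_pos rfl, integral_inv_mul_besselJ_mul_self (by linarith)]
    ring
  · rw [if_neg hlt.ne', zero_div]
    refine Eq.trans (integral_congr_ae (ae_of_all _ fun t => ?_))
      (integral_besselJ_mul_besselJ_of_lt (ν := ν) (by linarith) hlt)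
    exact mul_right_comm _ _ _
end

section
/- In dimension d ≥ 1, let s ∈ (0,1) and let u(x) = (1 - |x|²)_+^s for x ∈ ℝ^d. Then for all x with |x| < 1, the fractional Laplacian satisfies (-Δ)^s u(x) = 4^s Γ(d/2 + s) Γ(1+s) / Γ(d/2), a constant independent of x. -/
open MeasureTheory Filter
open scoped Real Topology

/-- The normalization constant `c_{d,s} = 4^s Γ(d/2+s)/(π^{d/2} |Γ(-s)|)` of the singular
integral definition of the fractional Laplacian. -/
noncomputable def fracLapConst (d : ℕ) (s : ℝ) : ℝ :=
  4 ^ s * Real.Gamma ((d : ℝ) / 2 + s) / (π ^ ((d : ℝ) / 2) * |Real.Gamma (-s)|)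

open Set Metric in
theorem integral_eq_integral_toSphere {E F : Type*} [NormedAddCommGroup E] [NormedSpace ℝ E]
    [MeasurableSpace E] [BorelSpace E] [FiniteDimensional ℝ E] [Nontrivial E]
    [NormedAddCommGroup F] [NormedSpace ℝ F]
    (μ : Measure E) [μ.IsAddHaarMeasure] {f : E → F} (hf : Integrable f μ) :
    ∫ x, f x ∂μ = ∫ θ : sphere (0 : E) 1, ∫ r in Ioi (0 : ℝ),
      r ^ (Module.finrank ℝ E - 1) • f (r • (θ : E)) ∂volume ∂μ.toSphere := by
  have hmp := μ.measurePreserving_homeomorphUnitSphereProd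
  have hemb := (homeomorphUnitSphereProd E).measurableEmbedding
  have hcomp : ∀ x : ({0}ᶜ : Set E), f (((homeomorphUnitSphereProd E x).2 : ℝ) •
      ((homeomorphUnitSphereProd E x).1 : E)) = f x := fun x => by
    congr 1
    exact congrArg Subtype.val ((homeomorphUnitSphereProd E).symm_apply_apply x)
  have hf_polar : Integrable (fun p : sphere (0 : E) 1 × Ioi (0 : ℝ) => f ((p.2 : ℝ) • (p.1 : E)))
      (μ.toSphere.prod (.volumeIoiPow (Module.finrank ℝ E - 1))) := by
    rw [← hmp.integrable_comp_emb hemb]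
    simp only [Function.comp_def, hcomp]
    exact (integrableOn_iff_comap_subtypeVal (measurableSet_singleton _).compl).1 hf.integrableOn
  calc
    ∫ x, f x ∂μ = ∫ x : ({(0)}ᶜ : Set E), f x.1 ∂(μ.comap (↑)) := by
      rw [integral_subtype_comap (measurableSet_singleton _).compl fun x ↦ f x,
        restrict_compl_singleton]
    _ = ∫ p, f ((p.2 : ℝ) • (p.1 : E))
          ∂μ.toSphere.prod (.volumeIoiPow (Module.finrank ℝ E - 1)) := by
      rw [← hmp.integral_comp hemb]
      simp only [hcomp]
    _ = _ := by
      rw [integral_prod _ hf_polar]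
      refine integral_congr_ae (.of_forall fun θ => ?_)
      simp only [Measure.volumeIoiPow, ENNReal.ofReal]
      rw [integral_withDensity_eq_integral_smul,
        integral_subtype_comap measurableSet_Ioi
          fun a ↦ Real.toNNReal (a ^ (Module.finrank ℝ E - 1)) • f (a • (θ : E)),
        setIntegral_congr_fun measurableSet_Ioi fun x hx ↦ ?_]
      · rw [NNReal.smul_def, Real.coe_toNNReal _ (pow_nonneg hx.out.le _)]
      · exact (measurable_subtype_coe.pow_const _).real_toNNReal

theorem intervalIntegrable_posPart_rpow {p : ℝ} (hp : -1 < p) (hp0 : p < 0) (a b : ℝ) :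
    IntervalIntegrable (fun y : ℝ => max y 0 ^ p) volume a b := by
  have h : (fun y : ℝ => max y 0 ^ p) = (Set.Ioi 0).indicator (fun y : ℝ => y ^ p) := by
    ext y
    rcases lt_or_ge 0 y with hy | hy
    · simp [hy, hy.le]
    · simp [not_lt.2 hy, hy, Real.zero_rpow hp0.ne]
  have h1 := intervalIntegral.intervalIntegrable_rpow' (a := a) (b := b) hp
  rw [intervalIntegrable_iff] at h1 ⊢
  rw [h]
  exact h1.indicator measurableSet_Ioi

theorem integral_posPart_rpow {s : ℝ} (hs0 : 0 < s) (hs1 : s < 1) (a b : ℝ) :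
    ∫ y in a..b, s * max y 0 ^ (s - 1) = max b 0 ^ s - max a 0 ^ s := by
  refine integral_eq_of_hasDerivAt_off_countable (fun y : ℝ => max y 0 ^ s) _
    (Set.countable_singleton 0) ?_ ?_ ?_
  · exact ((continuous_id.max continuous_const).rpow_const fun _ => .inr hs0.le).continuousOn
  · rintro x ⟨-, hx⟩
    rcases lt_or_gt_of_ne (show x ≠ 0 from hx) with h | h
    · rw [max_eq_right h.le, Real.zero_rpow (by linarith), mul_zero]
      refine (hasDerivAt_const x (0 : ℝ)).congr_of_eventuallyEq ?_
      filter_upwards [eventually_lt_nhds h] with y hy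
      rw [max_eq_right hy.le, Real.zero_rpow hs0.ne']
    · rw [max_eq_left h.le]
      refine (Real.hasDerivAt_rpow_const (.inl h.ne')).congr_of_eventuallyEq ?_
      filter_upwards [eventually_gt_nhds h] with y hy
      rw [max_eq_left hy.le]
  · exact (intervalIntegrable_posPart_rpow (by linarith) (by linarith) a b).const_mul s

theorem intervalIntegrable_beta {u v : ℝ} (hu : 0 < u) (hv : 0 < v) :
    IntervalIntegrable (fun x : ℝ => x ^ (u - 1) * (1 - x) ^ (v - 1)) volume 0 1 := by
  have h := Complex.betaIntegral_convergent (u := (u : ℂ)) (v := (v : ℂ)) (by simpa) (by simpa)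
  rw [intervalIntegrable_iff, Set.uIoc_of_le zero_le_one] at h ⊢
  refine IntegrableOn.congr_fun (Integrable.re h) (fun x hx => ?_) measurableSet_Ioc
  have h1 : 0 ≤ 1 - x := by linarith [hx.2]
  simp only [← Complex.ofReal_one, ← Complex.ofReal_sub, ← Complex.ofReal_cpow hx.1.le,
    ← Complex.ofReal_cpow h1, ← Complex.ofReal_mul]
  simp

theorem integral_beta {u v : ℝ} (hu : 0 < u) (hv : 0 < v) :
    ∫ x in (0 : ℝ)..1, x ^ (u - 1) * (1 - x) ^ (v - 1) = ProbabilityTheory.beta u v := by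
  rw [← Complex.ofReal_inj, ← intervalIntegral.integral_ofReal, ProbabilityTheory.beta]
  push_cast
  rw [← Complex.Gamma_ofReal, ← Complex.Gamma_ofReal, ← Complex.Gamma_ofReal,
    Complex.ofReal_add, ← Complex.betaIntegral_eq_Gamma_mul_div _ _ (by simpa) (by simpa),
    Complex.betaIntegral]
  refine intervalIntegral.integral_congr fun x hx => ?_
  rw [Set.uIcc_of_le zero_le_one] at hx
  rw [Complex.ofReal_cpow hx.1, Complex.ofReal_cpow (by linarith [hx.2])]
  simp

theorem one_sub_posPart_rpow_nonneg {s : ℝ} (hs0 : 0 < s) {y : ℝ} (hy : 0 ≤ y) :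
    0 ≤ 1 - max (1 - y) 0 ^ s :=
  sub_nonneg.2 (Real.rpow_le_one (le_max_right _ _) (max_le (by linarith) zero_le_one) hs0.le)

theorem one_sub_posPart_rpow_le {s : ℝ} (hs1 : s < 1) {y : ℝ} (hy : 0 ≤ y) (hy1 : y ≤ 1) :
    1 - max (1 - y) 0 ^ s ≤ y := by
  rw [max_eq_left (by linarith)]
  rcases hy1.eq_or_lt with rfl | h
  · linarith [Real.rpow_nonneg (sub_self (1 : ℝ)).ge s]
  · have := Real.rpow_le_rpow_of_exponent_ge (x := 1 - y) (by linarith) (by linarith) hs1.le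
    rw [Real.rpow_one] at this
    linarith

theorem integrableOn_one_sub_posPart_rpow_Ioc {s : ℝ} (hs0 : 0 < s) (hs1 : s < 1) :
    IntegrableOn (fun y : ℝ => (1 - max (1 - y) 0 ^ s) * y ^ (-1 - s)) (Set.Ioc 0 1) := by
  have h := intervalIntegral.intervalIntegrable_rpow' (a := 0) (b := 1) (show -1 < -s by linarith)
  rw [intervalIntegrable_iff, Set.uIoc_of_le zero_le_one] at h
  refine h.mono' (by fun_prop) ((ae_restrict_mem measurableSet_Ioc).mono fun y hy => ?_)
  have h0 := one_sub_posPart_rpow_nonneg hs0 hy.1.le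
  rw [Real.norm_of_nonneg (mul_nonneg h0 (Real.rpow_nonneg hy.1.le _))]
  calc _ ≤ y * y ^ (-1 - s) :=
        mul_le_mul_of_nonneg_right (one_sub_posPart_rpow_le hs1 hy.1.le hy.2)
          (Real.rpow_nonneg hy.1.le _)
    _ = y ^ (-s) := by
        rw [← Real.rpow_one_add' hy.1.le (by linarith)]
        congr 1
        ring

theorem eqOn_one_sub_posPart_rpow_Ioi {s : ℝ} (hs0 : 0 < s) :
    Set.EqOn (fun y : ℝ => y ^ (-1 - s))
      (fun y : ℝ => (1 - max (1 - y) 0 ^ s) * y ^ (-1 - s)) (Set.Ioi 1) := by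
  intro y (hy : 1 < y)
  simp only
  rw [max_eq_right (by linarith), Real.zero_rpow hs0.ne', sub_zero, one_mul]

theorem integrableOn_one_sub_posPart_rpow {s : ℝ} (hs0 : 0 < s) (hs1 : s < 1) :
    IntegrableOn (fun y : ℝ => (1 - max (1 - y) 0 ^ s) * y ^ (-1 - s)) (Set.Ioi 0) := by
  rw [← Set.Ioc_union_Ioi_eq_Ioi zero_le_one]
  exact (integrableOn_one_sub_posPart_rpow_Ioc hs0 hs1).union
    ((integrableOn_Ioi_rpow_of_lt (by linarith) one_pos).congr_fun
      (eqOn_one_sub_posPart_rpow_Ioi hs0) measurableSet_Ioi)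

theorem integral_one_sub_posPart_rpow {s : ℝ} (hs0 : 0 < s) (hs1 : s < 1) :
    ∫ y in Set.Ioi (0 : ℝ), (1 - max (1 - y) 0 ^ s) * y ^ (-1 - s) =
      ProbabilityTheory.beta (1 - s) s := by
  have hi := integrableOn_one_sub_posPart_rpow hs0 hs1
  rw [← Set.Ioc_union_Ioi_eq_Ioi zero_le_one] at hi ⊢
  rw [setIntegral_union (Set.Ioc_disjoint_Ioi le_rfl) measurableSet_Ioi hi.left_of_union
    hi.right_of_union, ← setIntegral_congr_fun measurableSet_Ioi
    (eqOn_one_sub_posPart_rpow_Ioi hs0), integral_Ioi_rpow_of_lt (by linarith) one_pos,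
    ← intervalIntegral.integral_of_le zero_le_one]
  have hI1 : IntervalIntegrable (fun y : ℝ => (1 - max (1 - y) 0 ^ s) * y ^ (-1 - s))
      volume 0 1 := by
    rw [intervalIntegrable_iff, Set.uIoc_of_le zero_le_one]
    exact integrableOn_one_sub_posPart_rpow_Ioc hs0 hs1
  have hI2 := intervalIntegrable_beta (show 0 < 1 - s by linarith) hs0
  have key := intervalIntegral.integral_eq_sub_of_hasDerivAt_of_le (a := 0) (b := 1)
    (f := fun y : ℝ => -s⁻¹ * (y ^ (-s) * (1 - max (1 - y) 0 ^ s)))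
    (f' := fun y : ℝ => (1 - max (1 - y) 0 ^ s) * y ^ (-1 - s) -
      y ^ (1 - s - 1) * (1 - y) ^ (s - 1)) zero_le_one ?_ ?_ (hI1.sub hI2)
  · rw [intervalIntegral.integral_sub hI1 hI2, integral_beta (by linarith) hs0] at key
    simp only [sub_self, max_self, Real.zero_rpow hs0.ne', Real.one_rpow, sub_zero,
      max_eq_left zero_le_one, mul_zero] at key
    rw [sub_eq_iff_eq_add.1 key, Real.one_rpow, show -1 - s + 1 = -s by ring]
    ring
  · intro y hy
    rcases hy.1.eq_or_lt with rfl | h0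
    · have hc : ContinuousAt (fun y : ℝ => y ^ (1 - s)) 0 :=
        Real.continuousAt_rpow_const _ _ (.inr (by linarith))
      rw [ContinuousAt, Real.zero_rpow (by linarith)] at hc
      refine ContinuousWithinAt.mul continuousWithinAt_const ?_
      rw [ContinuousWithinAt, Real.zero_rpow (by linarith), zero_mul]
      refine squeeze_zero_norm' ?_ (hc.mono_left nhdsWithin_le_nhds)
      filter_upwards [self_mem_nhdsWithin] with y hy
      have hn := one_sub_posPart_rpow_nonneg hs0 hy.1
      rw [Real.norm_of_nonneg (mul_nonneg (Real.rpow_nonneg hy.1 _) hn)]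
      calc _ ≤ y ^ (-s) * y := mul_le_mul_of_nonneg_left
            (one_sub_posPart_rpow_le hs1 hy.1 hy.2) (Real.rpow_nonneg hy.1 _)
        _ = y ^ (1 - s) := by
          rw [← Real.rpow_add_one' hy.1 (by linarith)]
          congr 1
          ring
    · refine ContinuousAt.continuousWithinAt ?_
      refine continuousAt_const.mul (ContinuousAt.mul
        (Real.continuousAt_rpow_const _ _ (.inl h0.ne')) (continuousAt_const.sub ?_))
      exact (((continuous_const.sub continuous_id).max continuous_const).rpow_const
        fun _ => .inr hs0.le).continuousAt
  · intro y hy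
    have h1 : 0 < 1 - y := by linarith [hy.2]
    have hd : HasDerivAt (fun y : ℝ => -s⁻¹ * (y ^ (-s) * (1 - (1 - y) ^ s)))
        (-s⁻¹ * ((-s) * y ^ (-s - 1) * (1 - (1 - y) ^ s) +
          y ^ (-s) * (0 - (-1) * s * (1 - y) ^ (s - 1)))) y := by
      refine HasDerivAt.const_mul _ (HasDerivAt.mul
        (Real.hasDerivAt_rpow_const (.inl hy.1.ne')) (HasDerivAt.sub (hasDerivAt_const _ _) ?_))
      exact ((hasDerivAt_id y).const_sub 1).rpow_const (.inl h1.ne')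
    rw [max_eq_left h1.le]
    convert! hd.congr_of_eventuallyEq ?_ using 1
    · rw [show -1 - s = -s - 1 by ring, show 1 - s - 1 = -s by ring]
      field_simp
      ring
    · filter_upwards [eventually_lt_nhds hy.2] with z hz
      rw [max_eq_left (by linarith)]

theorem posPart_quadratic_rpow_le {a s : ℝ} (ha : 0 ≤ a) (hs : 0 ≤ s) (b t : ℝ) :
    max (a + b * t - t ^ 2) 0 ^ s ≤ (a + b ^ 2 / 4) ^ s :=
  Real.rpow_le_rpow (le_max_right _ _)
    (max_le (by nlinarith [sq_nonneg (t - b / 2)]) (by positivity)) hs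

theorem integrableOn_posPart_quadratic_rpow {a s ε : ℝ} (ha : 0 ≤ a) (hs : 0 < s) (hε : 0 < ε)
    (b : ℝ) :
    IntegrableOn (fun t : ℝ => max (a + b * t - t ^ 2) 0 ^ s * t ^ (-1 - 2 * s)) (Set.Ioi ε) := by
  refine ((integrableOn_Ioi_rpow_of_lt (a := -1 - 2 * s) (by linarith) hε).const_mul
    ((a + b ^ 2 / 4) ^ s)).mono' (by fun_prop)
    ((ae_restrict_mem measurableSet_Ioi).mono fun t (ht : ε < t) => ?_)
  have ht0 := Real.rpow_nonneg (hε.trans ht).le (-1 - 2 * s)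
  rw [Real.norm_of_nonneg (mul_nonneg (Real.rpow_nonneg (le_max_right _ _) _) ht0)]
  exact mul_le_mul_of_nonneg_right (posPart_quadratic_rpow_le ha hs.le b t) ht0

theorem integral_deriv_posPart_quadratic_rpow {s t : ℝ} (hs0 : 0 < s) (hs1 : s < 1) (ht : 0 < t)
    (a b : ℝ) :
    ∫ β in (0 : ℝ)..b, s * max (a + β * t - t ^ 2) 0 ^ (s - 1) * t ^ (-2 * s) =
      max (a + b * t - t ^ 2) 0 ^ s * t ^ (-1 - 2 * s) -
        max (a + 0 * t - t ^ 2) 0 ^ s * t ^ (-1 - 2 * s) := by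
  have h := intervalIntegral.integral_comp_mul_add (a := 0) (b := b)
    (fun y => s * max y 0 ^ (s - 1)) ht.ne' (a - t ^ 2)
  rw [integral_posPart_rpow hs0 hs1] at h
  rw [intervalIntegral.integral_mul_const,
    show (-1 - 2 * s) = -2 * s - 1 by ring, Real.rpow_sub_one ht.ne', ← sub_mul]
  have h2 : ∀ β : ℝ, t * β + (a - t ^ 2) = a + β * t - t ^ 2 := fun β => by ring
  simp only [h2] at h
  rw [h, smul_eq_mul]
  ring

theorem integrable_deriv_posPart_quadratic_rpow {a s ε : ℝ} (ha : 0 ≤ a) (hs0 : 0 < s)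
    (hs1 : s < 1) (hε : 0 < ε) (b : ℝ) :
    Integrable (Function.uncurry fun β t : ℝ =>
      s * max (a + β * t - t ^ 2) 0 ^ (s - 1) * t ^ (-2 * s))
      ((volume.restrict (Set.uIoc 0 b)).prod (volume.restrict (Set.Ioi ε))) := by
  have hnn : ∀ β t : ℝ, 0 < t →
      0 ≤ s * max (a + β * t - t ^ 2) 0 ^ (s - 1) * t ^ (-2 * s) := fun β t ht =>
    mul_nonneg (mul_nonneg hs0.le (Real.rpow_nonneg (le_max_right _ _) _))
      (Real.rpow_nonneg ht.le _)
  rw [integrable_prod_iff' (by unfold Function.uncurry; fun_prop)]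
  refine ⟨(ae_restrict_mem measurableSet_Ioi).mono fun t (ht : ε < t) => ?_, ?_⟩
  · have ht0 := hε.trans ht
    have h3 : IntervalIntegrable (fun β => max (a + β * t - t ^ 2) 0 ^ (s - 1)) volume 0 b := by
      have h := ((intervalIntegrable_posPart_rpow (p := s - 1) (by linarith) (by linarith)
        (t * 0 + (a - t ^ 2)) (t * b + (a - t ^ 2))).comp_add_right (a - t ^ 2)).comp_mul_left
        (c := t)
      rw [add_sub_cancel_right, add_sub_cancel_right, mul_div_cancel_left₀ _ ht0.ne',
        mul_div_cancel_left₀ _ ht0.ne'] at h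
      have h2 : ∀ β : ℝ, t * β + (a - t ^ 2) = a + β * t - t ^ 2 := fun β => by ring
      simpa only [h2] using h
    rw [intervalIntegrable_iff] at h3
    exact (h3.const_mul s).mul_const (t ^ (-2 * s))
  · refine Integrable.congr (((integrableOn_posPart_quadratic_rpow ha hs0 hε b).sub
      (integrableOn_posPart_quadratic_rpow ha hs0 hε 0)).norm)
      ((ae_restrict_mem measurableSet_Ioi).mono fun t (ht : ε < t) => ?_)
    have ht0 := hε.trans ht
    simp only [Function.uncurry, Pi.sub_apply]
    rw [← integral_deriv_posPart_quadratic_rpow hs0 hs1 ht0,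
      intervalIntegral.norm_integral_eq_norm_integral_uIoc]
    simp_rw [Real.norm_of_nonneg (hnn _ t ht0)]
    exact Real.norm_of_nonneg (integral_nonneg fun β => hnn β t ht0)

theorem integral_posPart_quadratic_rpow_sub {a s ε : ℝ} (ha : 0 ≤ a) (hs0 : 0 < s)
    (hs1 : s < 1) (hε : 0 < ε) (b : ℝ) :
    (∫ t in Set.Ioi ε, max (a + b * t - t ^ 2) 0 ^ s * t ^ (-1 - 2 * s)) -
      ∫ t in Set.Ioi ε, max (a + 0 * t - t ^ 2) 0 ^ s * t ^ (-1 - 2 * s) =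
    ∫ β in (0 : ℝ)..b, ∫ t in Set.Ioi ε,
      s * max (a + β * t - t ^ 2) 0 ^ (s - 1) * t ^ (-2 * s) := by
  rw [intervalIntegral_integral_swap (integrable_deriv_posPart_quadratic_rpow ha hs0 hs1 hε b),
    ← integral_sub (integrableOn_posPart_quadratic_rpow ha hs0 hε b)
      (integrableOn_posPart_quadratic_rpow ha hs0 hε 0)]
  exact setIntegral_congr_fun measurableSet_Ioi fun t ht =>
    (integral_deriv_posPart_quadratic_rpow hs0 hs1 (hε.trans ht) a b).symm

theorem intervalIntegrable_integral_deriv_posPart_quadratic_rpow {a s ε : ℝ} (ha : 0 ≤ a)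
    (hs0 : 0 < s) (hs1 : s < 1) (hε : 0 < ε) (b : ℝ) :
    IntervalIntegrable (fun β => ∫ t in Set.Ioi ε,
      s * max (a + β * t - t ^ 2) 0 ^ (s - 1) * t ^ (-2 * s)) volume 0 b := by
  rw [intervalIntegrable_iff]
  exact (integrable_deriv_posPart_quadratic_rpow ha hs0 hs1 hε b).integral_prod_left

theorem integral_deriv_posPart_quadratic_rpow_Ioi {a s ε : ℝ} (ha : 0 < a) (hε : 0 < ε) (β : ℝ) :
    ∫ t in Set.Ioi ε, s * max (a + β * t - t ^ 2) 0 ^ (s - 1) * t ^ (-2 * s) =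
      s * a ^ (-s) * ∫ ρ in Set.Ioo (β / 2) (a / ε + β / 2),
        max (ρ ^ 2 - (a + β ^ 2 / 4)) 0 ^ (s - 1) := by
  have himg : (fun t : ℝ => a / t + β / 2) '' Set.Ioi ε =
      Set.Ioo (β / 2) (a / ε + β / 2) := by
    ext ρ
    constructor
    · rintro ⟨t, ht : ε < t, rfl⟩
      have : 0 < a / t := div_pos ha (hε.trans ht)
      have h2 : a / t < a / ε := div_lt_div_of_pos_left ha hε ht
      exact ⟨by simp only; linarith, by simp only; linarith⟩
    · rintro ⟨h1, h2⟩
      have h3 : 0 < ρ - β / 2 := by linarith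
      refine ⟨a / (ρ - β / 2), ?_, ?_⟩
      · rw [Set.mem_Ioi, lt_div_iff₀ h3, mul_comm, ← lt_div_iff₀ hε]
        linarith
      · simp only
        rw [div_div_cancel₀ ha.ne']
        ring
  rw [← himg, integral_image_eq_integral_abs_deriv_smul (f' := fun t => -a / t ^ 2)
    measurableSet_Ioi, ← integral_const_mul]
  · refine setIntegral_congr_fun measurableSet_Ioi fun t (ht : ε < t) => ?_
    have ht0 : 0 < t := hε.trans ht
    have h0 : 0 < a / t ^ 2 := by positivity
    rw [neg_div, abs_neg, abs_of_pos h0, smul_eq_mul,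
      show (a / t + β / 2) ^ 2 - (a + β ^ 2 / 4) = a / t ^ 2 * (a + β * t - t ^ 2) by
        field_simp; ring,
      show max (a / t ^ 2 * (a + β * t - t ^ 2)) 0 = a / t ^ 2 * max (a + β * t - t ^ 2) 0 by
        rw [mul_max_of_nonneg _ _ h0.le, mul_zero],
      Real.mul_rpow h0.le (le_max_right _ _), Real.rpow_sub_one h0.ne',
      Real.div_rpow ha.le (by positivity), Real.rpow_neg ha.le, ← Real.rpow_natCast,
      ← Real.rpow_mul ht0.le, show -2 * s = -((2 : ℕ) * s) by push_cast; ring,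
      Real.rpow_neg ht0.le]
    have h1 := (Real.rpow_pos_of_pos ha s).ne'
    have h2 := (Real.rpow_pos_of_pos ht0 ((2 : ℕ) * s)).ne'
    have h3 := (Real.rpow_pos_of_pos ht0 ((2 : ℕ))).ne'
    field_simp
  · intro t (ht : ε < t)
    have ht0 : t ≠ 0 := (hε.trans ht).ne'
    have := ((hasDerivAt_inv ht0).const_mul a).add_const (β / 2)
    simp only [← div_eq_mul_inv] at this
    convert! this.hasDerivWithinAt using 1
    field_simp
  · intro t (ht : ε < t) t' (ht' : ε < t') h
    have ht0 : t ≠ 0 := (hε.trans ht).ne'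
    have ht0' : t' ≠ 0 := (hε.trans ht').ne'
    have h' : a / t = a / t' := by simpa using h
    rw [div_eq_div_iff ht0 ht0'] at h'
    exact (mul_left_cancel₀ ha.ne' h').symm

theorem setIntegral_posPart_sq_sub_rpow {a s : ℝ} (ha : 0 ≤ a) (hs1 : s < 1) (β : ℝ) {M : ℝ}
    (hM : 0 ≤ M) :
    ∫ ρ in Set.Ioo (β / 2) M, max (ρ ^ 2 - (a + β ^ 2 / 4)) 0 ^ (s - 1) =
      ∫ ρ in (0 : ℝ)..M, max (ρ ^ 2 - (a + β ^ 2 / 4)) 0 ^ (s - 1) := by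
  rw [intervalIntegral.integral_of_le hM, integral_Ioc_eq_integral_Ioo,
    ← integral_indicator measurableSet_Ioo, ← integral_indicator measurableSet_Ioo]
  congr 1
  ext ρ
  rcases le_or_gt (ρ ^ 2 - (a + β ^ 2 / 4)) 0 with h | h
  · have h0 : max (ρ ^ 2 - (a + β ^ 2 / 4)) 0 ^ (s - 1) = 0 := by
      rw [max_eq_right h, Real.zero_rpow (by linarith)]
    simp only [Set.indicator_apply, h0, ite_self]
  · have hiff : β / 2 < ρ ↔ 0 < ρ := by
      constructor
      · intro h1
        by_contra! h2
        nlinarith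
      · intro h1
        by_contra! h2
        nlinarith
    simp only [Set.indicator_apply, Set.mem_Ioo, hiff]

theorem intervalIntegrable_posPart_sq_sub_rpow {D s : ℝ} (hD : 0 < D) (hs0 : 0 < s) (hs1 : s < 1)
    {M : ℝ} (hM : 0 ≤ M) :
    IntervalIntegrable (fun ρ : ℝ => max (ρ ^ 2 - D) 0 ^ (s - 1)) volume 0 M := by
  have h := ((intervalIntegrable_posPart_rpow (p := s - 1) (by linarith) (by linarith)
    (0 - √D) (M - √D)).comp_sub_right √D).const_mul (√D ^ (s - 1))
  simp only [sub_add_cancel] at h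
  rw [intervalIntegrable_iff, Set.uIoc_of_le hM] at h ⊢
  refine h.mono' (Measurable.aestronglyMeasurable (by fun_prop))
    ((ae_restrict_mem measurableSet_Ioc).mono fun ρ hρ => ?_)
  have hD' : 0 < √D := Real.sqrt_pos.2 hD
  have hfac : ρ ^ 2 - D = (ρ + √D) * (ρ - √D) := by
    linear_combination Real.sq_sqrt hD.le
  have h0 : 0 < ρ + √D := by linarith [hρ.1]
  rw [Real.norm_of_nonneg (Real.rpow_nonneg (le_max_right _ _) _), hfac,
    show max ((ρ + √D) * (ρ - √D)) 0 = (ρ + √D) * max (ρ - √D) 0 by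
      rw [mul_max_of_nonneg _ _ h0.le, mul_zero],
    Real.mul_rpow h0.le (le_max_right _ _)]
  exact mul_le_mul_of_nonneg_right
    (Real.rpow_le_rpow_of_nonpos hD' (by linarith [hρ.1]) (by linarith))
    (Real.rpow_nonneg (le_max_right _ _) _)

theorem abs_integral_deriv_posPart_quadratic_rpow_sub_neg_le {a s ε B β L : ℝ} (ha : 0 < a)
    (hs0 : 0 < s) (hs1 : s < 1) (hε : 0 < ε) (hβ : |β| ≤ B) (hB : B / 2 ≤ a / ε) (hL : 0 < L)
    (hLB : a + B ^ 2 / 4 + L ≤ (a / ε - B / 2) ^ 2) :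
    |(∫ t in Set.Ioi ε, s * max (a + β * t - t ^ 2) 0 ^ (s - 1) * t ^ (-2 * s)) -
      ∫ t in Set.Ioi ε, s * max (a + (-β) * t - t ^ 2) 0 ^ (s - 1) * t ^ (-2 * s)| ≤
      s * a ^ (-s) * (L ^ (s - 1) * B) := by
  obtain ⟨hβ1, hβ2⟩ := abs_le.1 hβ
  have hM1 : 0 ≤ a / ε + β / 2 := by linarith
  have hM2 : 0 ≤ a / ε + -β / 2 := by linarith
  have hc : 0 ≤ s * a ^ (-s) := by positivity
  rw [integral_deriv_posPart_quadratic_rpow_Ioi ha hε,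
    integral_deriv_posPart_quadratic_rpow_Ioi ha hε,
    setIntegral_posPart_sq_sub_rpow ha.le hs1 _ hM1,
    setIntegral_posPart_sq_sub_rpow ha.le hs1 _ hM2, neg_sq, ← mul_sub, abs_mul, abs_of_nonneg hc,
    intervalIntegral.integral_interval_sub_left
      (intervalIntegrable_posPart_sq_sub_rpow (by positivity) hs0 hs1 hM1)
      (intervalIntegrable_posPart_sq_sub_rpow (by positivity) hs0 hs1 hM2)]
  refine mul_le_mul_of_nonneg_left ?_ hc
  have hlen : |(a / ε + β / 2) - (a / ε + -β / 2)| ≤ B := by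
    rwa [show (a / ε + β / 2) - (a / ε + -β / 2) = β by ring]
  refine (intervalIntegral.norm_integral_le_of_norm_le_const (E := ℝ) (C := L ^ (s - 1))
    fun ρ hρ => ?_).trans (mul_le_mul_of_nonneg_left hlen (Real.rpow_nonneg hL.le _))
  have hρ' : a / ε - B / 2 ≤ ρ := by
    rcases Set.mem_uIoc.1 hρ with h | h <;> linarith [h.1]
  have hβB : β ^ 2 ≤ B ^ 2 := sq_le_sq' hβ1 hβ2
  have hLρ : L ≤ ρ ^ 2 - (a + β ^ 2 / 4) := by
    have := pow_le_pow_left₀ (sub_nonneg.2 hB) hρ' 2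
    linarith
  rw [Real.norm_of_nonneg (Real.rpow_nonneg (le_max_right _ _) _), max_eq_left (by linarith)]
  exact Real.rpow_le_rpow_of_nonpos hL hLρ (by linarith)

/-- The truncated second-difference integral of the weight along a chord. -/
noncomputable def chordIntegral (a s ε b : ℝ) : ℝ :=
  ∫ t in Set.Ioi ε, (2 * a ^ s - max (a + b * t - t ^ 2) 0 ^ s -
    max (a + (-b) * t - t ^ 2) 0 ^ s) * t ^ (-1 - 2 * s)

theorem chordIntegral_eq_sub {a s ε : ℝ} (ha : 0 < a)
    (hs0 : 0 < s) (hε : 0 < ε) (b : ℝ) :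
    chordIntegral a s ε b = 2 * a ^ s * (∫ t in Set.Ioi ε, t ^ (-1 - 2 * s)) -
      (∫ t in Set.Ioi ε, max (a + b * t - t ^ 2) 0 ^ s * t ^ (-1 - 2 * s)) -
      ∫ t in Set.Ioi ε, max (a + (-b) * t - t ^ 2) 0 ^ s * t ^ (-1 - 2 * s) := by
  have h1 : IntegrableOn (fun t : ℝ => 2 * a ^ s * t ^ (-1 - 2 * s)) (Set.Ioi ε) :=
    (integrableOn_Ioi_rpow_of_lt (by linarith) hε).const_mul _
  have h2 := integrableOn_posPart_quadratic_rpow ha.le hs0 hε b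
  rw [← integral_const_mul, ← integral_sub h1 h2, ← integral_sub (f := fun t : ℝ =>
    2 * a ^ s * t ^ (-1 - 2 * s) - max (a + b * t - t ^ 2) 0 ^ s * t ^ (-1 - 2 * s)) (h1.sub h2)
      (integrableOn_posPart_quadratic_rpow ha.le hs0 hε (-b))]
  exact integral_congr_ae (.of_forall fun t => by ring)

theorem abs_chordIntegral_sub_le {a s ε B b L : ℝ} (ha : 0 < a)
    (hs0 : 0 < s) (hs1 : s < 1) (hε : 0 < ε) (hb : |b| ≤ B) (hB : B / 2 ≤ a / ε) (hL : 0 < L)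
    (hLB : a + B ^ 2 / 4 + L ≤ (a / ε - B / 2) ^ 2) :
    |chordIntegral a s ε b - chordIntegral a s ε 0| ≤
      s * a ^ (-s) * (L ^ (s - 1) * B) * B := by
  have hB0 : 0 ≤ B := (abs_nonneg b).trans hb
  have h1 := integral_posPart_quadratic_rpow_sub ha.le hs0 hs1 hε b
  have h2 := integral_posPart_quadratic_rpow_sub ha.le hs0 hs1 hε (-b)
  have hi1 := intervalIntegrable_integral_deriv_posPart_quadratic_rpow ha.le hs0 hs1 hε b
  have hi2 := intervalIntegrable_integral_deriv_posPart_quadratic_rpow ha.le hs0 hs1 hε (-b)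
  have h3 := intervalIntegral.integral_comp_neg (a := 0) (b := b) fun β => ∫ t in Set.Ioi ε,
    s * max (a + β * t - t ^ 2) 0 ^ (s - 1) * t ^ (-2 * s)
  rw [neg_zero, intervalIntegral.integral_symm 0 (-b)] at h3
  have hi3 := (IntervalIntegrable.iff_comp_neg).1 hi2
  rw [neg_zero, neg_neg] at hi3
  have h4 := intervalIntegral.integral_sub hi1 hi3
  have h5 := chordIntegral_eq_sub ha hs0 hε b
  have h6 := chordIntegral_eq_sub ha hs0 hε 0
  rw [neg_zero] at h6
  have h7 : chordIntegral a s ε b - chordIntegral a s ε 0 = -∫ β in (0 : ℝ)..b,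
      ((∫ t in Set.Ioi ε, s * max (a + β * t - t ^ 2) 0 ^ (s - 1) * t ^ (-2 * s)) -
        ∫ t in Set.Ioi ε, s * max (a + (-β) * t - t ^ 2) 0 ^ (s - 1) * t ^ (-2 * s)) := by
    rw [h4, h3, ← h1, ← h2, h5, h6]
    ring
  have h8 := Real.rpow_pos_of_pos hL (s - 1)
  rw [h7, abs_neg]
  refine (intervalIntegral.norm_integral_le_of_norm_le_const (E := ℝ)
    (C := s * a ^ (-s) * (L ^ (s - 1) * B)) fun β hβ =>
    abs_integral_deriv_posPart_quadratic_rpow_sub_neg_le ha hs0 hs1 hε ?_ hB hL hLB).trans ?_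
  · refine le_trans ?_ hb
    simpa using Set.abs_sub_left_of_mem_uIcc (Set.uIoc_subset_uIcc hβ)
  · rw [sub_zero]
    exact mul_le_mul_of_nonneg_left hb (by positivity)

theorem chordIntegral_zero (a s ε : ℝ) :
    chordIntegral a s ε 0 = ∫ t in Set.Ioi ε,
      2 * (a ^ s - max (a - t ^ 2) 0 ^ s) * t ^ (-1 - 2 * s) := by
  refine setIntegral_congr_fun measurableSet_Ioi fun t _ => ?_
  simp only [neg_zero, zero_mul, add_zero]
  ring

theorem rpow_sub_posPart_eq_comp {a s t : ℝ} (ha : 0 < a) (ht : 0 < t) :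
    2 * (a ^ s - max (a - t ^ 2) 0 ^ s) * t ^ (-1 - 2 * s) =
      (|2| * t ^ ((2 : ℝ) - 1)) • (a⁻¹ * ((1 - max (1 - a⁻¹ * t ^ (2 : ℝ)) 0 ^ s) *
        (a⁻¹ * t ^ (2 : ℝ)) ^ (-1 - s))) := by
  have h1 : a - t ^ 2 = a * (1 - a⁻¹ * t ^ (2 : ℝ)) := by
    rw [mul_sub, mul_inv_cancel_left₀ ha.ne', mul_one, Real.rpow_two]
  rw [h1, show max (a * (1 - a⁻¹ * t ^ (2 : ℝ))) 0 = a * max (1 - a⁻¹ * t ^ (2 : ℝ)) 0 by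
      rw [mul_max_of_nonneg _ _ ha.le, mul_zero],
    Real.mul_rpow ha.le (le_max_right _ _), Real.mul_rpow (by positivity) (by positivity),
    ← Real.rpow_mul ht.le, Real.inv_rpow ha.le, ← Real.rpow_neg ha.le, smul_eq_mul,
    show -(-1 - s) = s + 1 by ring, Real.rpow_add_one ha.ne',
    show (-1 - 2 * s) = ((2 : ℝ) - 1) + 2 * (-1 - s) by ring, Real.rpow_add ht, abs_two]
  field_simp

theorem tendsto_chordIntegral_zero {a s : ℝ} (ha : 0 < a) (hs0 : 0 < s) (hs1 : s < 1) :
    Tendsto (fun ε => chordIntegral a s ε 0) (𝓝[>] 0)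
      (𝓝 (ProbabilityTheory.beta (1 - s) s)) := by
  have hK := integrableOn_one_sub_posPart_rpow hs0 hs1
  have hK' : IntegrableOn (fun τ : ℝ => a⁻¹ * ((1 - max (1 - a⁻¹ * τ) 0 ^ s) *
      (a⁻¹ * τ) ^ (-1 - s))) (Set.Ioi 0) := by
    have := (integrableOn_Ioi_comp_mul_left_iff
      (fun y : ℝ => (1 - max (1 - y) 0 ^ s) * y ^ (-1 - s)) 0 (inv_pos.2 ha)).2 (by simpa using hK)
    exact this.const_mul _
  have hvalue : ∫ τ in Set.Ioi (0 : ℝ), a⁻¹ * ((1 - max (1 - a⁻¹ * τ) 0 ^ s) *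
      (a⁻¹ * τ) ^ (-1 - s)) = ProbabilityTheory.beta (1 - s) s := by
    rw [integral_const_mul, integral_comp_mul_left_Ioi
      (fun y : ℝ => (1 - max (1 - y) 0 ^ s) * y ^ (-1 - s)) 0 (inv_pos.2 ha), mul_zero,
      integral_one_sub_posPart_rpow hs0 hs1, smul_eq_mul, inv_inv, inv_mul_cancel_left₀ ha.ne']
  have heq : Set.EqOn (fun t => (|2| * t ^ ((2 : ℝ) - 1)) • (a⁻¹ *
      ((1 - max (1 - a⁻¹ * t ^ (2 : ℝ)) 0 ^ s) * (a⁻¹ * t ^ (2 : ℝ)) ^ (-1 - s))))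
      (fun t => 2 * (a ^ s - max (a - t ^ 2) 0 ^ s) * t ^ (-1 - 2 * s)) (Set.Ioi 0) :=
    fun t ht => (rpow_sub_posPart_eq_comp ha ht).symm
  rw [← integrableOn_Ioi_comp_rpow_iff _ (two_ne_zero (α := ℝ))] at hK'
  rw [← integral_comp_rpow_Ioi _ (two_ne_zero (α := ℝ)),
    setIntegral_congr_fun measurableSet_Ioi heq] at hvalue
  have hJ := hK'.congr_fun heq measurableSet_Ioi
  have hcov : AECover (volume.restrict (Set.Ioi (0 : ℝ))) (𝓝[>] (0 : ℝ)) fun ε => Set.Ioi ε :=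
    aecover_Ioi_of_Ioi (tendsto_id.mono_left nhdsWithin_le_nhds)
  have hlim := hcov.integral_tendsto_of_countably_generated hJ
  rw [hvalue] at hlim
  refine hlim.congr' ?_
  filter_upwards [self_mem_nhdsWithin] with ε hε
  rw [chordIntegral_zero, Measure.restrict_restrict measurableSet_Ioi,
    Set.inter_eq_self_of_subset_left (Set.Ioi_subset_Ioi (le_of_lt hε))]

theorem eventually_abs_chordIntegral_sub_le {a s : ℝ} (ha : 0 < a) (hs0 : 0 < s) (hs1 : s < 1)
    (B : ℝ) {δ : ℝ} (hδ : 0 < δ) :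
    ∀ᶠ ε in 𝓝[>] (0 : ℝ), ∀ b, |b| ≤ B →
      |chordIntegral a s ε b - ProbabilityTheory.beta (1 - s) s| ≤ δ := by
  have h0 := (Metric.tendsto_nhds.1 (tendsto_chordIntegral_zero ha hs0 hs1)) (δ / 2) (half_pos hδ)
  have hL : ∀ᶠ L : ℝ in atTop, s * a ^ (-s) * (L ^ (s - 1) * B) * B ≤ δ / 2 := by
    have h := (tendsto_rpow_neg_atTop (show 0 < 1 - s by linarith)).const_mul
      (s * a ^ (-s) * B * B)
    rw [mul_zero] at h
    filter_upwards [h.eventually_le_const (half_pos hδ)] with L hL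
    refine le_of_eq_of_le ?_ hL
    rw [neg_sub]
    ring
  obtain ⟨L, hL, hL0⟩ := (hL.and (eventually_gt_atTop 0)).exists
  have hN : Tendsto (fun ε : ℝ => a / ε - B / 2) (𝓝[>] 0) atTop :=
    tendsto_atTop_add_const_right _ _ (tendsto_inv_nhdsGT_zero.const_mul_atTop ha)
  filter_upwards [self_mem_nhdsWithin, h0, hN.eventually_ge_atTop 0,
    ((tendsto_pow_atTop two_ne_zero).comp hN).eventually_ge_atTop (a + B ^ 2 / 4 + L)]
    with ε hε h0 hN0 hNL b hb
  have h1 := abs_chordIntegral_sub_le ha hs0 hs1 hε hb (by linarith) hL0 hNL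
  rw [Real.dist_eq] at h0
  calc _ ≤ _ := abs_sub_le _ (chordIntegral a s ε 0) _
    _ ≤ δ := by linarith

theorem integrable_indicator_norm_rpow {E : Type*} [NormedAddCommGroup E] [NormedSpace ℝ E]
    [MeasurableSpace E] [BorelSpace E] [FiniteDimensional ℝ E] [Nontrivial E]
    (μ : Measure E) [μ.IsAddHaarMeasure] {p ε : ℝ} (hp : p < -Module.finrank ℝ E) (hε : 0 < ε) :
    Integrable (fun z : E => (Set.Ici ε).indicator (fun r => r ^ p) ‖z‖) μ := by
  rw [integrable_fun_norm_addHaar]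
  have hd : 1 ≤ Module.finrank ℝ E := Module.finrank_pos
  have h : IntegrableOn (fun r : ℝ => r ^ ((Module.finrank ℝ E - 1 : ℕ) + p)) (Set.Ici ε) := by
    rw [integrableOn_Ici_iff_integrableOn_Ioi]
    refine integrableOn_Ioi_rpow_of_lt ?_ hε
    push_cast [hd]
    linarith
  refine ((integrable_indicator_iff measurableSet_Ici).2 h).integrableOn.congr_fun
    (fun r (hr : 0 < r) => ?_) measurableSet_Ioi
  simp only [Set.indicator_apply, smul_eq_mul, mul_ite, mul_zero]
  rw [Real.rpow_add hr, Real.rpow_natCast]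

theorem integral_truncated_eq_integral_chordIntegral {E : Type*} [NormedAddCommGroup E]
    [InnerProductSpace ℝ E] [MeasurableSpace E] [BorelSpace E] [FiniteDimensional ℝ E]
    [Nontrivial E] (μ : Measure E) [μ.IsAddHaarMeasure] {s : ℝ} (hs0 : 0 < s) {x : E}
    (hx : ‖x‖ < 1) {ε : ℝ} (hε : 0 < ε) :
    ∫ y in {y : E | ε ≤ dist x y}, (max (1 - ‖x‖ ^ 2) 0 ^ s - max (1 - ‖y‖ ^ 2) 0 ^ s) /
        ‖x - y‖ ^ ((Module.finrank ℝ E : ℝ) + 2 * s) ∂μ =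
      2⁻¹ * ∫ θ : Metric.sphere (0 : E) 1,
        chordIntegral (1 - ‖x‖ ^ 2) s ε (2 * inner ℝ x (θ : E)) ∂μ.toSphere := by
  have hd : 1 ≤ Module.finrank ℝ E := Module.finrank_pos
  set n := Module.finrank ℝ E with hn
  set u : E → ℝ := fun y => max (1 - ‖y‖ ^ 2) 0 ^ s with hu
  have hu0 : ∀ y, 0 ≤ u y := fun y => Real.rpow_nonneg (le_max_right _ _) _
  have hu1 : ∀ y, u y ≤ 1 := fun y => Real.rpow_le_one (le_max_right _ _)
    (max_le (by linarith [sq_nonneg ‖y‖]) zero_le_one) hs0.le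
  have hum : Measurable u := by fun_prop
  set w : E → ℝ := fun z => (Set.Ici ε).indicator (fun r : ℝ => r ^ (-((n : ℝ) + 2 * s))) ‖z‖
    with hw
  have hwi : Integrable w μ := integrable_indicator_norm_rpow μ (by linarith) hε
  set f : E → ℝ := fun z => (u x - u (x + z)) * w z with hf
  have hfi : Integrable f μ := by
    refine hwi.bdd_mul (c := 1)
      (measurable_const.sub (hum.comp (measurable_const_add x))).aestronglyMeasurable
      (.of_forall fun z => ?_)
    rw [Real.norm_eq_abs, abs_le]
    constructor <;> linarith [hu0 x, hu0 (x + z), hu1 x, hu1 (x + z)]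
  have hms : MeasurableSet {y : E | ε ≤ dist x y} :=
    measurableSet_le measurable_const (by fun_prop)
  have h1 : ∫ y in {y : E | ε ≤ dist x y}, (u x - u y) / ‖x - y‖ ^ ((n : ℝ) + 2 * s) ∂μ =
      ∫ z, f z ∂μ := by
    rw [← integral_indicator hms, ← integral_add_left_eq_self _ x]
    refine integral_congr_ae (.of_forall fun z => ?_)
    simp only [Set.indicator_apply, hf, hw, Set.mem_ofPred_eq, Set.mem_Ici, dist_self_add_right,
      sub_add_cancel_left, norm_neg, mul_ite, mul_zero, Real.rpow_neg (norm_nonneg _),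
      div_eq_mul_inv]
  have h2 : ∫ z, f z ∂μ = 2⁻¹ * ∫ z, (f z + f (-z)) ∂μ := by
    rw [integral_add hfi hfi.comp_neg, integral_neg_eq_self]
    ring
  rw [h1, h2, integral_eq_integral_toSphere μ (f := fun z => f z + f (-z)) (hfi.add hfi.comp_neg)]
  congr 2
  ext θ
  have hθ : ‖(θ : E)‖ = 1 := by simp
  have hax : max (1 - ‖x‖ ^ 2) 0 = 1 - ‖x‖ ^ 2 := max_eq_left (by nlinarith [norm_nonneg x])
  rw [chordIntegral, ← integral_Ici_eq_integral_Ioi (x := ε),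
    ← integral_indicator measurableSet_Ici,
    ← integral_indicator measurableSet_Ioi]
  congr 1
  ext r
  by_cases hr : ε ≤ r
  · have hr0 : 0 < r := hε.trans_le hr
    have hq : ∀ c : ℝ, 1 - ‖x + (c * r) • (θ : E)‖ ^ 2 =
        1 - ‖x‖ ^ 2 + (-c) * (2 * inner ℝ x (θ : E)) * r - c ^ 2 * r ^ 2 := fun c => by
      rw [norm_add_sq_real, inner_smul_right, norm_smul, hθ, mul_one, Real.norm_eq_abs, sq_abs]
      ring
    have hq1 := hq 1
    have hq2 := hq (-1)
    simp only [one_mul, neg_one_mul, neg_neg, one_pow, neg_sq] at hq1 hq2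
    have hnr : ‖r • (θ : E)‖ = r := by rw [norm_smul, hθ, mul_one, Real.norm_of_nonneg hr0.le]
    rw [Set.indicator_of_mem (show r ∈ Set.Ioi (0 : ℝ) from hr0),
      Set.indicator_of_mem (show r ∈ Set.Ici ε from hr)]
    have hp : r ^ (n - 1) * r ^ (-((n : ℝ) + 2 * s)) = r ^ (-1 - 2 * s) := by
      rw [← Real.rpow_natCast, ← Real.rpow_add hr0]
      congr 1
      push_cast [hd]
      ring
    have hnr2 : ‖-r • (θ : E)‖ = r := by rw [neg_smul, norm_neg, hnr]
    simp only [hf, hw, hu, ← neg_smul, hnr, hnr2, ← hn,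
      Set.indicator_of_mem (show r ∈ Set.Ici ε from hr), hq1, hq2, hax, smul_eq_mul]
    rw [← hp]
    ring
  · rw [Set.indicator_of_notMem (show r ∉ Set.Ici ε from hr), Set.indicator_apply_eq_zero]
    intro hr0
    have hnr : ‖r • (θ : E)‖ = r := by rw [norm_smul, hθ, mul_one, Real.norm_of_nonneg hr0.le]
    simp only [hf, hw, norm_neg, hnr, Set.indicator_of_notMem (show r ∉ Set.Ici ε from hr),
      mul_zero, add_zero, smul_zero]

theorem fracLapConst_mul_sphere_mul_beta {d : ℕ} (hd : 1 ≤ d) {s : ℝ} (hs0 : 0 < s)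
    (hs1 : s < 1) :
    fracLapConst d s * (2⁻¹ * ((volume : Measure (EuclideanSpace ℝ (Fin d))).toSphere.real .univ *
      ProbabilityTheory.beta (1 - s) s)) =
    4 ^ s * Real.Gamma ((d : ℝ) / 2 + s) * Real.Gamma (1 + s) / Real.Gamma ((d : ℝ) / 2) := by
  have : NeZero d := ⟨by lia⟩
  have hd0 : (0 : ℝ) < d := by exact_mod_cast hd
  have hG := Real.Gamma_pos_of_pos (half_pos hd0)
  have hG1 := Real.Gamma_pos_of_pos (show 0 < 1 - s by linarith)
  have hpi := Real.rpow_pos_of_pos Real.pi_pos ((d : ℝ) / 2)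
  have hneg : |Real.Gamma (-s)| = Real.Gamma (1 - s) / s := by
    have h := Real.Gamma_add_one (neg_ne_zero.2 hs0.ne')
    rw [neg_add_eq_sub] at h
    rw [← abs_of_pos hG1, h, abs_mul, abs_neg, abs_of_pos hs0, mul_div_cancel_left₀ _ hs0.ne']
  have hsq : √π ^ d = π ^ ((d : ℝ) / 2) := by
    rw [Real.sqrt_eq_rpow, ← Real.rpow_mul_natCast Real.pi_pos.le]
    congr 1
    ring
  have hball : (volume : Measure (EuclideanSpace ℝ (Fin d))).real (Metric.ball 0 1) =
      π ^ ((d : ℝ) / 2) / Real.Gamma ((d : ℝ) / 2 + 1) := by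
    rw [measureReal_def, EuclideanSpace.volume_ball, Fintype.card_fin, ENNReal.ofReal_one, one_pow,
      one_mul, hsq, ENNReal.toReal_ofReal]
    exact div_nonneg hpi.le (Real.Gamma_pos_of_pos (by positivity)).le
  rw [Measure.toSphere_real_apply_univ, hball, finrank_euclideanSpace_fin, ProbabilityTheory.beta,
    sub_add_cancel, Real.Gamma_one, fracLapConst, hneg, Real.Gamma_add_one (by positivity),
    add_comm 1 s, Real.Gamma_add_one hs0.ne']
  field_simp

theorem stronglyMeasurable_chordIntegral (a s ε : ℝ) :
    StronglyMeasurable (chordIntegral a s ε) := by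
  refine StronglyMeasurable.integral_prod_right (f := fun b t => (2 * a ^ s -
    max (a + b * t - t ^ 2) 0 ^ s - max (a + (-b) * t - t ^ 2) 0 ^ s) * t ^ (-1 - 2 * s)) ?_
  refine Measurable.stronglyMeasurable ?_
  unfold Function.uncurry
  fun_prop

/-- Let `d ≥ 1`, `s ∈ (0,1)` and `u(x) = (1-|x|²)_+^s` on `ℝ^d`. Then for
`|x| < 1` the fractional Laplacian (as a principal value singular integral) equals the
constant `4^s Γ(d/2+s) Γ(1+s) / Γ(d/2)`. -/
theorem fracLap_weight_const (d : ℕ) (hd : 1 ≤ d) (s : ℝ) (hs0 : 0 < s) (hs1 : s < 1)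
    (u : EuclideanSpace ℝ (Fin d) → ℝ)
    (hu : u = fun y => max (1 - ‖y‖ ^ 2) 0 ^ s)
    (x : EuclideanSpace ℝ (Fin d)) (hx : ‖x‖ < 1) :
    Tendsto
      (fun ε : ℝ =>
        fracLapConst d s *
          ∫ y in {y : EuclideanSpace ℝ (Fin d) | ε ≤ dist x y},
            (u x - u y) / ‖x - y‖ ^ ((d : ℝ) + 2 * s))
      (𝓝[>] 0)
      (𝓝 (4 ^ s * Real.Gamma ((d : ℝ) / 2 + s) * Real.Gamma (1 + s) /
        Real.Gamma ((d : ℝ) / 2))) := by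
  have : NeZero d := ⟨by lia⟩
  subst hu
  rw [← fracLapConst_mul_sphere_mul_beta hd hs0 hs1]
  refine Tendsto.const_mul _ ?_
  set σ := (volume : Measure (EuclideanSpace ℝ (Fin d))).toSphere
  have ha : 0 < 1 - ‖x‖ ^ 2 := by nlinarith [norm_nonneg x]
  suffices h : Tendsto (fun ε => ∫ θ, chordIntegral (1 - ‖x‖ ^ 2) s ε
      (2 * inner ℝ x (θ : EuclideanSpace ℝ (Fin d))) ∂σ) (𝓝[>] 0)
      (𝓝 (σ.real .univ * ProbabilityTheory.beta (1 - s) s)) by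
    refine (h.const_mul 2⁻¹).congr' ?_
    filter_upwards [self_mem_nhdsWithin] with ε hε
    rw [← integral_truncated_eq_integral_chordIntegral volume hs0 hx hε,
      finrank_euclideanSpace_fin]
  have hev : ∀ δ : ℝ, 0 < δ → ∀ᶠ ε in 𝓝[>] 0,
      ∀ θ : Metric.sphere (0 : EuclideanSpace ℝ (Fin d)) 1,
      |chordIntegral (1 - ‖x‖ ^ 2) s ε (2 * inner ℝ x (θ : EuclideanSpace ℝ (Fin d))) -
        ProbabilityTheory.beta (1 - s) s| ≤ δ := fun δ hδ => by
    filter_upwards [eventually_abs_chordIntegral_sub_le ha hs0 hs1 2 hδ] with ε hε θ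
    refine hε _ ?_
    have hθ : ‖(θ : EuclideanSpace ℝ (Fin d))‖ = 1 := by simp
    have h := abs_real_inner_le_norm x (θ : EuclideanSpace ℝ (Fin d))
    rw [hθ, mul_one] at h
    rw [abs_mul, abs_two]
    linarith
  rw [← smul_eq_mul, ← integral_const]
  refine tendsto_integral_filter_of_dominated_convergence
    (fun _ => |ProbabilityTheory.beta (1 - s) s| + 1) (.of_forall fun ε => ?_) ?_
    (integrable_const _) (.of_forall fun θ => ?_)
  · exact ((stronglyMeasurable_chordIntegral _ s ε).comp_measurable
      (by fun_prop)).aestronglyMeasurable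
  · filter_upwards [hev 1 one_pos] with ε hε
    refine .of_forall fun θ => ?_
    rw [Real.norm_eq_abs, ← sub_le_iff_le_add']
    exact (abs_sub_abs_le_abs_sub _ _).trans (hε θ)
  · refine Metric.tendsto_nhds.2 fun δ hδ => ?_
    filter_upwards [hev (δ / 2) (half_pos hδ)] with ε hε
    exact (hε θ).trans_lt (half_lt_self hδ)
end
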